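/- Let h = 2n+1 be an odd integer with n ≥ 1, let 0 ≤ i ≤ n, let σ be an h-bar-core with exactly k ≥ 1 addable i-nodes and let τ = ψ_i(σ), so that P_{σ,2} and P_{τ,2} form a [2:k]-pair of residue i; assume either i ≥ 1 or k ≥ 3. If λ, μ ∈ P_{σ,2} both have no removable i-node and |∂λ − ∂μ| ≤ 1, then λ ⊴ μ if and only if ψ_i(λ) ⊴ ψ_i(μ). -/

import Mathlib

/-- A partition: a weakly decreasing sequence of non-negative integers with
finite sum (finitely many nonzero parts), indexed from 0 (so `parts 0` is λ₁). -/
structure BPartition where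
  parts : ℕ →₀ ℕ
  antitone : ∀ r, parts (r + 1) ≤ parts r

namespace BPartition

/-- The multiset of positive parts of a partition. -/
def partsM (lam : BPartition) : Multiset ℕ :=
  lam.parts.support.val.map (fun r => lam.parts r)

/-- The Young diagram: nodes `(r, c)` with rows indexed from 0 and columns from 1. -/
def diagram (lam : BPartition) : Set (ℕ × ℕ) :=
  {x | 1 ≤ x.2 ∧ x.2 ≤ lam.parts x.1}

/-- A partition is strict if λ_r > λ_{r+1} whenever λ_r > 0. -/
def IsStrict (lam : BPartition) : Prop :=
  ∀ r, 0 < lam.parts r → lam.parts (r + 1) < lam.parts r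

/-- A partition is h-strict if each part is either strictly bigger than the next,
or positive and divisible by h, or zero. -/
def IsHStrict (h : ℕ) (lam : BPartition) : Prop :=
  ∀ r, lam.parts (r + 1) < lam.parts r ∨ (0 < lam.parts r ∧ h ∣ lam.parts r) ∨ lam.parts r = 0

/-- An h-strict partition is restricted if for every r either λ_{r+1} > λ_r − h,
or λ_{r+1} = λ_r − h and h does not divide λ_r. -/
def IsRestricted (h : ℕ) (lam : BPartition) : Prop :=
  ∀ r, lam.parts r < lam.parts (r + 1) + h ∨
    (lam.parts (r + 1) + h = lam.parts r ∧ ¬ h ∣ lam.parts r)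

/-- The residue of a node in column c (1-indexed): the smaller of the residues of
c − 1 and of −c modulo h. -/
def colRes (h c : ℕ) : ℕ := min ((c - 1) % h) ((h - c % h) % h)

/-- `x` is an addable i-node of `lam`. -/
def Addable (h i : ℕ) (lam : BPartition) (x : ℕ × ℕ) : Prop :=
  colRes h x.2 = i ∧ x ∉ diagram lam ∧
  ∃ nu : BPartition, IsHStrict h nu ∧ diagram lam ⊆ diagram nu ∧ x ∈ diagram nu ∧
    ∀ y ∈ diagram nu, y ∉ diagram lam → colRes h y.2 = i

/-- `x` is a removable i-node of `lam`. -/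
def Removable (h i : ℕ) (lam : BPartition) (x : ℕ × ℕ) : Prop :=
  x ∈ diagram lam ∧
  ∃ mu : BPartition, IsHStrict h mu ∧ diagram mu ⊆ diagram lam ∧ x ∉ diagram mu ∧
    ∀ y ∈ diagram lam, y ∉ diagram mu → colRes h y.2 = i

/-- Removal of a single h-bar from `lam` giving `mu`, recording the value `v`:
either a part `v ≥ h` is replaced by `v − h` (deleted if `v = h`), or two parts
summing to `h` are deleted, in which case `v` is the larger of the two. -/
def barStepRec (h : ℕ) (lam mu : BPartition) (v : ℕ) : Prop :=
  IsHStrict h mu ∧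
  ((v = h ∧ v ∈ partsM lam ∧ partsM mu = (partsM lam).erase v) ∨
   (h < v ∧ v ∈ partsM lam ∧ partsM mu = (v - h) ::ₘ (partsM lam).erase v) ∨
   (∃ a b : ℕ, a + b = h ∧ a ∈ partsM lam ∧ b ∈ (partsM lam).erase a ∧
      v = max a b ∧ partsM mu = ((partsM lam).erase a).erase b))

/-- Removal of a single h-bar. -/
def barStep (h : ℕ) (lam mu : BPartition) : Prop :=
  ∃ v, barStepRec h lam mu v

/-- An h-bar-core: an h-strict partition from which no h-bar can be removed. -/
def IsBarCore (h : ℕ) (lam : BPartition) : Prop :=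
  IsHStrict h lam ∧ ∀ mu, ¬ barStep h lam mu

/-- A chain of `w` h-bar removals from `lam` down to `mu`. -/
def barChain (h : ℕ) : ℕ → BPartition → BPartition → Prop
  | 0, lam, mu => lam = mu
  | w + 1, lam, mu => ∃ nu, barStep h lam nu ∧ barChain h w nu mu

/-- `lam ∈ P_{τ,w}`: `lam` is h-strict with h-bar-core `tau` and h-bar-weight `w`. -/
def InBlock (h : ℕ) (tau : BPartition) (w : ℕ) (lam : BPartition) : Prop :=
  IsHStrict h lam ∧ IsBarCore h tau ∧ barChain h w lam tau

/-- The left-to-right order on node positions along the edge of a Young diagram: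
smaller column first; within a column, larger row first. -/
def posLE (x y : ℕ × ℕ) : Prop := x.2 < y.2 ∨ (x.2 = y.2 ∧ y.1 ≤ x.1)

/-- `x` is a normal i-node: a removable i-node surviving (as a − sign) in the
reduced i-signature; equivalently, every window of the i-signature ending at `x`
contains strictly more removable than addable i-nodes. -/
def Normal (h i : ℕ) (lam : BPartition) (x : ℕ × ℕ) : Prop :=
  Removable h i lam x ∧ ∀ z : ℕ × ℕ, posLE z x →
    Set.ncard {y | Addable h i lam y ∧ posLE z y ∧ posLE y x} <
      Set.ncard {y | Removable h i lam y ∧ posLE z y ∧ posLE y x}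

/-- `x` is a conormal i-node: an addable i-node surviving (as a + sign) in the
reduced i-signature. -/
def Conormal (h i : ℕ) (lam : BPartition) (x : ℕ × ℕ) : Prop :=
  Addable h i lam x ∧ ∀ z : ℕ × ℕ, posLE x z →
    Set.ncard {y | Removable h i lam y ∧ posLE x y ∧ posLE y z} <
      Set.ncard {y | Addable h i lam y ∧ posLE x y ∧ posLE y z}

/-- The node set of ψ_i(λ): add the leftmost s − r conormal i-nodes if s ≥ r,
remove the rightmost r − s normal i-nodes if r > s, where r = #normal and
s = #conormal i-nodes. -/
noncomputable def psiSet (h i : ℕ) (lam : BPartition) : Set (ℕ × ℕ) :=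
  if Set.ncard {x | Normal h i lam x} ≤ Set.ncard {x | Conormal h i lam x} then
    diagram lam ∪ {x | Conormal h i lam x ∧
      Set.ncard {y | Conormal h i lam y ∧ posLE y x} ≤
        Set.ncard {x | Conormal h i lam x} - Set.ncard {x | Normal h i lam x}}
  else
    diagram lam \ {x | Normal h i lam x ∧
      Set.ncard {y | Normal h i lam y ∧ posLE x y} ≤
        Set.ncard {x | Normal h i lam x} - Set.ncard {x | Conormal h i lam x}}

open Classical in
/-- The involution ψ_i. -/
noncomputable def psi (h i : ℕ) (lam : BPartition) : BPartition :=
  if hex : ∃ mu : BPartition, diagram mu = psiSet h i lam then hex.choose else lam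

/-- The set of occupied positions of the abacus display of a strict partition. -/
def abacus (lam : BPartition) : Set ℤ :=
  {a | a = 0 ∨ (0 < a ∧ a.toNat ∈ partsM lam) ∨ (a < 0 ∧ (-a).toNat ∉ partsM lam)}

/-- The dominance order: λ ⊴ μ. -/
def domLE (lam mu : BPartition) : Prop :=
  ∀ r, ∑ s ∈ Finset.range r, lam.parts s ≤ ∑ s ∈ Finset.range r, mu.parts s

/-- Strict dominance: λ ◁ μ. -/
def domLT (lam mu : BPartition) : Prop := domLE lam mu ∧ lam ≠ mu

/-- Lexicographic order: λ <lex μ. -/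
def lexLT (lam mu : BPartition) : Prop :=
  ∃ r, lam.parts r < mu.parts r ∧ ∀ s < r, lam.parts s = mu.parts s

/-- Colexicographic order: λ <colex μ. -/
def colexLT (lam mu : BPartition) : Prop :=
  ∃ r, mu.parts r < lam.parts r ∧ ∀ s, r < s → lam.parts s = mu.parts s

/-- λ ↔ᵢ μ: every node of the symmetric difference of the diagrams has residue i. -/
def Link (h i : ℕ) (lam mu : BPartition) : Prop :=
  ∀ x : ℕ × ℕ, x ∈ (diagram lam \ diagram mu) ∪ (diagram mu \ diagram lam) →
    colRes h x.2 = i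

/-- `a ≤ b` are the bar positions of `lam ∈ P_{τ,2}`: the values recorded by
some two-step removal of h-bars from `lam` down to `tau`. -/
def BarPositions (h : ℕ) (tau lam : BPartition) (a b : ℕ) : Prop :=
  a ≤ b ∧ ∃ (nu : BPartition) (v₁ v₂ : ℕ), barStepRec h lam nu v₁ ∧ barStepRec h nu tau v₂ ∧
    ({a, b} : Multiset ℕ) = {v₁, v₂}

/-- The leg length of the bar of `lam ∈ P_{τ,2}` at bar position `c`. -/
noncomputable def legLen (h : ℕ) (tau lam : BPartition) (c : ℕ) : ℕ :=
  if h ≤ c then Set.ncard {x : ℕ | c - h < x ∧ x < c ∧ x ∈ partsM lam ∧ x ∈ partsM tau}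
  else (h - c) + Set.ncard {x : ℕ | h - c < x ∧ x < c ∧ x ∈ partsM lam ∧ x ∈ partsM tau}

/-- ∂λ: the absolute difference of the two leg lengths of `lam`, whose bar
positions are `a ≤ b`. -/
noncomputable def ddd (h : ℕ) (tau lam : BPartition) (a b : ℕ) : ℕ :=
  max (legLen h tau lam a) (legLen h tau lam b) - min (legLen h tau lam a) (legLen h tau lam b)

inductive Colour | black | white | grey
deriving DecidableEq

/-- β(τ): the number of parts of τ less than h. -/
def betaCount (h : ℕ) (tau : BPartition) : ℕ :=
  Multiset.card ((partsM tau).filter (fun x => x < h))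

/-- The leg length of a 2h-bar of `lam` with larger bar position `b`. -/
noncomputable def legLen2 (h : ℕ) (tau lam : BPartition) (b : ℕ) : ℕ :=
  if 2 * h ≤ b then Set.ncard {x : ℕ | b - 2 * h < x ∧ x < b ∧ x ∈ partsM lam ∧ x ∈ partsM tau}
  else (2 * h - b) + Set.ncard {x : ℕ | 2 * h - b < x ∧ x < b ∧ x ∈ partsM lam ∧ x ∈ partsM tau}

/-- The colour of `lam ∈ P_{τ,2}` with bar positions `a ≤ b`. -/
noncomputable def colour (h : ℕ) (tau lam : BPartition) (a b : ℕ) : Colour :=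
  if 2 ≤ ddd h tau lam a b then Colour.grey
  else if ddd h tau lam a b = 1 then
    if h < b then Colour.grey
    else if (min (legLen h tau lam a) (legLen h tau lam b) + betaCount h tau) % 2 = 1 then
      Colour.black else Colour.white
  else
    if b = a + h ∨ a + b = 2 * h then
      if (legLen2 h tau lam b + 2 * betaCount h tau) % 4 = 0 ∨
         (legLen2 h tau lam b + 2 * betaCount h tau) % 4 = 3 then Colour.black
      else Colour.white
    else
      if (legLen h tau lam a + betaCount h tau) % 2 = 1 then Colour.black else Colour.white

end BPartition

namespace BPartition

theorem anti (lam : BPartition) {r s : ℕ} (hrs : r ≤ s) : lam.parts s ≤ lam.parts r :=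
  antitone_nat_of_succ_le (f := fun r => lam.parts r) lam.antitone hrs

theorem ext' {lam mu : BPartition} (hp : ∀ r, lam.parts r = mu.parts r) : lam = mu := by
  obtain ⟨p, hp1⟩ := lam
  obtain ⟨q, hq1⟩ := mu
  have : p = q := Finsupp.ext hp
  subst this
  rfl

theorem diagram_sub_iff {lam mu : BPartition} :
    diagram lam ⊆ diagram mu ↔ ∀ r, lam.parts r ≤ mu.parts r := by
  constructor
  · intro hs r
    rcases Nat.eq_zero_or_pos (lam.parts r) with h0 | h0
    · omega
    · have : (r, lam.parts r) ∈ diagram lam := ⟨h0, le_refl _⟩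
      exact (hs this).2
  · rintro hs ⟨r, c⟩ ⟨h1, h2⟩
    exact ⟨h1, le_trans h2 (hs r)⟩

theorem diagram_inj {lam mu : BPartition} (hd : diagram lam = diagram mu) : lam = mu := by
  apply ext'
  intro r
  exact le_antisymm (diagram_sub_iff.1 hd.le r) (diagram_sub_iff.1 hd.ge r)

theorem mem_partsM {lam : BPartition} {x : ℕ} :
    x ∈ partsM lam ↔ 0 < x ∧ ∃ r, lam.parts r = x := by
  simp only [partsM, Multiset.mem_map, Finset.mem_val, Finsupp.mem_support_iff]
  constructor
  · rintro ⟨r, h1, rfl⟩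
    exact ⟨Nat.pos_of_ne_zero h1, r, rfl⟩
  · rintro ⟨h1, r, rfl⟩
    exact ⟨r, by omega, rfl⟩

/-- a bound for the support -/
theorem exists_bound (lam : BPartition) : ∃ N, ∀ r, N ≤ r → lam.parts r = 0 := by
  obtain ⟨N, hN⟩ := lam.parts.support.exists_nat_subset_range
  refine ⟨N, fun r hr => ?_⟩
  by_contra hne
  have := hN (Finsupp.mem_support_iff.2 hne)
  simp at this
  omega

/-- sum of φ over positive parts -/
def FF (φ : ℕ → ℕ) (lam : BPartition) : ℕ := ((partsM lam).map φ).sum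

theorem FF_eq (φ : ℕ → ℕ) (hφ : φ 0 = 0) (lam : BPartition) (N : ℕ)
    (hN : ∀ r, N ≤ r → lam.parts r = 0) :
    FF φ lam = ∑ r ∈ Finset.range N, φ (lam.parts r) := by
  have h1 : FF φ lam = ∑ r ∈ lam.parts.support, φ (lam.parts r) := by
    simp [FF, partsM, Multiset.map_map]
  rw [h1]
  apply Finset.sum_subset
  · intro r hr
    rw [Finsupp.mem_support_iff] at hr
    simp only [Finset.mem_range]
    by_contra hc
    exact hr (hN r (by omega))
  · intro r _ hr
    rw [Finsupp.notMem_support_iff] at hr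
    rw [hr, hφ]

theorem prefix_le (lam : BPartition) (x r : ℕ) :
    ∑ s ∈ Finset.range r, lam.parts s ≤ FF (fun p => p - x) lam + r * x := by
  obtain ⟨N, hN⟩ := exists_bound lam
  rw [FF_eq _ (by simp) lam (max N r) (fun s hs => hN s (by omega))]
  calc ∑ s ∈ Finset.range r, lam.parts s
      ≤ ∑ s ∈ Finset.range r, ((lam.parts s - x) + x) :=
        Finset.sum_le_sum (fun s _ => by omega)
    _ = ∑ s ∈ Finset.range r, (lam.parts s - x) + r * x := by
        rw [Finset.sum_add_distrib]; simp
    _ ≤ _ := by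
        gcongr
        omega

theorem prefix_eq (lam : BPartition) (x r : ℕ) (h1 : ∀ s < r, x ≤ lam.parts s)
    (h2 : ∀ s, r ≤ s → lam.parts s ≤ x) :
    ∑ s ∈ Finset.range r, lam.parts s = FF (fun p => p - x) lam + r * x := by
  obtain ⟨N, hN⟩ := exists_bound lam
  rw [FF_eq _ (by simp) lam (max N r) (fun s hs => hN s (by omega))]
  have : ∑ s ∈ Finset.range (max N r), (lam.parts s - x)
      = ∑ s ∈ Finset.range r, (lam.parts s - x) := by
    symm
    apply Finset.sum_subset
    · intro s hs
      simp at hs ⊢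
      omega
    · intro s _ hs
      simp at hs
      have := h2 s hs
      omega
  rw [this]
  calc ∑ s ∈ Finset.range r, lam.parts s
      = ∑ s ∈ Finset.range r, ((lam.parts s - x) + x) :=
        Finset.sum_congr rfl (fun s hs => by
          have := h1 s (by simpa using hs)
          omega)
    _ = _ := by rw [Finset.sum_add_distrib]; simp

theorem domLE_iff (lam mu : BPartition) :
    domLE lam mu ↔ ∀ x, FF (fun p => p - x) lam ≤ FF (fun p => p - x) mu := by
  constructor
  · intro hd x
    have hex : ∃ r, lam.parts r ≤ x := by
      obtain ⟨N, hN⟩ := exists_bound lam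
      exact ⟨N, by rw [hN N le_rfl]; omega⟩
    classical
    have e := prefix_eq lam x (Nat.find hex)
      (fun s hs => by have := Nat.find_min hex hs; omega)
      (fun s hs => le_trans (anti lam hs) (Nat.find_spec hex))
    have e2 := prefix_le mu x (Nat.find hex)
    have := hd (Nat.find hex)
    omega
  · intro hf r
    have e := prefix_eq mu (mu.parts r) r (fun s hs => anti mu hs.le) (fun s hs => anti mu hs)
    have e2 := prefix_le lam (mu.parts r) r
    have := hf (mu.parts r)
    omega

/-- constructor -/
theorem exists_mk (f : ℕ → ℕ) (hf : ∀ r, f (r + 1) ≤ f r) (N : ℕ) (hN : ∀ r, N ≤ r → f r = 0) :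
    ∃ lam : BPartition, ∀ r, lam.parts r = f r := by
  refine ⟨⟨Finsupp.onFinset (Finset.range N) f ?_, ?_⟩, ?_⟩
  · intro r hr
    simp only [Finset.mem_range]
    by_contra hc
    exact hr (hN r (by omega))
  · intro r
    exact hf r
  · intro r
    rfl

theorem hstrict_lt {h : ℕ} {lam : BPartition} (hs : IsHStrict h lam) {r s : ℕ} (hrs : r < s)
    (hnd : ¬ h ∣ lam.parts r) : lam.parts s < lam.parts r := by
  have h1 := anti lam (show r + 1 ≤ s from hrs)
  rcases hs r with h2 | h2 | h2
  · omega
  · exact absurd h2.2 hnd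
  · rw [h2] at hnd
    exact absurd (dvd_zero h) hnd

theorem count_partsM (lam : BPartition) (x : ℕ) (hx : 0 < x) (N : ℕ)
    (hN : ∀ r, N ≤ r → lam.parts r = 0) :
    (partsM lam).count x = ((Finset.range N).filter (fun r => lam.parts r = x)).card := by
  unfold partsM
  rw [Multiset.count_map, ← Finset.filter_val, Finset.card_val]
  congr 1
  ext r
  simp only [Finset.mem_filter, Finsupp.mem_support_iff, Finset.mem_range]
  constructor
  · rintro ⟨h1, h2⟩
    refine ⟨?_, h2.symm⟩
    by_contra hc
    exact h1 (hN r (by omega))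
  · rintro ⟨h1, h2⟩
    exact ⟨by omega, h2.symm⟩

theorem hstrict_iff (h : ℕ) (lam : BPartition) :
    IsHStrict h lam ↔ ∀ x, ¬ h ∣ x → (partsM lam).count x ≤ 1 := by
  obtain ⟨N, hN⟩ := exists_bound lam
  constructor
  · intro hs x hx
    have hx0 : 0 < x := Nat.pos_of_ne_zero (fun h0 => hx (h0 ▸ dvd_zero h))
    rw [count_partsM lam x hx0 N hN, Finset.card_le_one]
    intro r hr s hs'
    simp only [Finset.mem_filter, Finset.mem_range] at hr hs'
    by_contra hne
    rcases Nat.lt_or_gt_of_ne hne with hlt | hlt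
    · have := hstrict_lt hs hlt (by rw [hr.2]; exact hx)
      omega
    · have := hstrict_lt hs hlt (by rw [hs'.2]; exact hx)
      omega
  · intro hc r
    by_contra hcon
    push Not at hcon
    obtain ⟨h1, h2, h3⟩ := hcon
    have hpos : 0 < lam.parts r := by omega
    have h4 := hc _ (h2 hpos)
    rw [count_partsM lam _ hpos N hN, Finset.card_le_one] at h4
    have heq : lam.parts (r + 1) = lam.parts r := le_antisymm (lam.antitone r) h1
    have hlt : ∀ s, 0 < lam.parts s → s < N := by
      intro s hs
      by_contra hcc
      rw [hN s (by omega)] at hs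
      omega
    have := h4 r (by simp [hlt r hpos]) (r + 1) (by simp [hlt (r+1) (by omega), heq])
    omega

theorem exists_partsM (M : Multiset ℕ) (h0 : 0 ∉ M) : ∃ lam : BPartition, partsM lam = M := by
  induction hn : M.card generalizing M with
  | zero =>
    obtain rfl := Multiset.card_eq_zero.1 hn
    exact ⟨⟨0, by simp⟩, by simp [partsM]⟩
  | succ n ih =>
    -- remove a maximal element
    have hne : M.toFinset.Nonempty := by
      rw [Multiset.toFinset_nonempty]
      rintro rfl
      simp at hn
    set m := M.toFinset.max' hne with hm
    have hmM : m ∈ M := Multiset.mem_toFinset.1 (Finset.max'_mem _ hne)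
    have hmax : ∀ x ∈ M, x ≤ m := fun x hx =>
      Finset.le_max' _ _ (Multiset.mem_toFinset.2 hx)
    obtain ⟨lam, hl⟩ := ih (M.erase m) (fun hc => h0 (Multiset.mem_of_mem_erase hc))
      (by rw [Multiset.card_erase_of_mem hmM, hn]; rfl)
    obtain ⟨N, hN⟩ := exists_bound lam
    obtain ⟨nu, hnu⟩ := exists_mk (fun r => if r = 0 then m else lam.parts (r - 1))
      (by
        intro r
        rcases r with _ | r
        · simp
          rcases Nat.eq_zero_or_pos (lam.parts 0) with hz | hz
          · omega
          · have : lam.parts 0 ∈ partsM lam := mem_partsM.2 ⟨hz, 0, rfl⟩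
            rw [hl] at this
            exact hmax _ (Multiset.mem_of_mem_erase this)
        · simpa using lam.antitone r)
      (N + 1) (by
        intro r hr
        rw [if_neg (by omega)]
        exact hN _ (by omega))
    refine ⟨nu, ?_⟩
    have hm0 : 0 < m := Nat.pos_of_ne_zero (fun hc => h0 (hc ▸ hmM))
    rw [← Multiset.cons_erase hmM, ← hl]
    ext x
    rcases Nat.eq_zero_or_pos x with rfl | hx
    · have e1 : Multiset.count 0 (partsM nu) = 0 :=
        Multiset.count_eq_zero.2 (fun hc => by have := (mem_partsM.1 hc).1; omega)
      have e2 : Multiset.count 0 (m ::ₘ partsM lam) = 0 := by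
        apply Multiset.count_eq_zero.2
        intro hc
        rcases Multiset.mem_cons.1 hc with hc | hc
        · omega
        · have := (mem_partsM.1 hc).1
          omega
      rw [e1, e2]
    · rw [count_partsM nu x hx (N + 1) (by
        intro r hr
        rw [hnu, if_neg (by omega)]
        exact hN _ (by omega)), Multiset.count_cons, count_partsM lam x hx N hN]
      rw [Finset.card_filter, Finset.card_filter, Finset.sum_range_succ']
      simp [hnu, eq_comm]

end BPartition

namespace BPartition

/-- left positions for residue i -/
def LL (h i : ℕ) (z : ℤ) : Prop := (h : ℤ) ∣ z - i ∨ (h : ℤ) ∣ z + i + 1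

theorem colRes_iff {n h i c : ℕ} (hh : h = 2 * n + 1) (hi : i ≤ n) (hc : 1 ≤ c) :
    colRes h c = i ↔ LL h i ((c : ℤ) - 1) := by
  obtain ⟨d, rfl⟩ : ∃ d, c = d + 1 := ⟨c - 1, by omega⟩
  have hpos : 0 < h := by omega
  have ht := Nat.mod_lt d hpos
  have hdm := Nat.mod_add_div d h
  set t := d % h with htd
  set q := d / h with hq
  have e1 : (d + 1 - 1) % h = t := by simp [htd]
  have e2 : (h - (d + 1) % h) % h = h - 1 - t := by
    by_cases hlt : t + 1 < h
    · have : (d + 1) % h = t + 1 := by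
        rw [← hdm, show t + h * q + 1 = (t + 1) + h * q by ring, Nat.add_mul_mod_self_left,
          Nat.mod_eq_of_lt hlt]
      rw [this, Nat.mod_eq_of_lt (by omega)]
      omega
    · have hte : t + 1 = h := by omega
      have : (d + 1) % h = 0 := by
        rw [← hdm, show t + h * q + 1 = (t + 1) + h * q by ring, Nat.add_mul_mod_self_left,
          hte, Nat.mod_self]
      rw [this]
      simp
      omega
  unfold colRes LL
  rw [e1, e2]
  have f1 : (h : ℤ) ∣ ((d + 1 : ℕ) : ℤ) - 1 - i ↔ t = i := by
    have : (((d + 1 : ℕ) : ℤ) - 1 - i) = ((t : ℤ) - i) + h * q := by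
      push_cast [← hdm]; ring
    rw [this, Int.dvd_add_left (Dvd.intro _ rfl)]
    constructor
    · intro hdv
      have := Int.eq_zero_of_abs_lt_dvd hdv (by rw [abs_lt]; omega)
      omega
    · rintro rfl
      simp
  have f2 : (h : ℤ) ∣ ((d + 1 : ℕ) : ℤ) - 1 + i + 1 ↔ t + i + 1 = h := by
    have : (((d + 1 : ℕ) : ℤ) - 1 + i + 1) = ((t : ℤ) + i + 1 - h) + h * (q + 1) := by
      push_cast [← hdm]; ring
    rw [this, Int.dvd_add_left (Dvd.intro _ rfl)]
    constructor
    · intro hdv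
      have := Int.eq_zero_of_abs_lt_dvd hdv (by rw [abs_lt]; omega)
      omega
    · intro he
      have : (t : ℤ) + i + 1 - h = 0 := by omega
      simp [this]
  rw [f1, f2]
  omega

theorem psi_eq {h i : ℕ} {lam nu : BPartition} (hu : ∀ x, ¬ Removable h i lam x)
    (hs : IsHStrict h nu) (hle : ∀ r, lam.parts r ≤ nu.parts r)
    (hres : ∀ r c, lam.parts r < c → c ≤ nu.parts r → colRes h c = i)
    (hmax : ∀ nu' : BPartition, IsHStrict h nu' → (∀ r, lam.parts r ≤ nu'.parts r) →
      (∀ r c, lam.parts r < c → c ≤ nu'.parts r → colRes h c = i) →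
      ∀ r, nu'.parts r ≤ nu.parts r) : psi h i lam = nu := by
  have hadd : {x | Addable h i lam x} = diagram nu \ diagram lam := by
    ext ⟨r, c⟩
    constructor
    · rintro ⟨_, hnl, nu', hs', hsub, hx, hr⟩
      refine ⟨⟨hx.1, hx.2.trans (hmax nu' hs' (diagram_sub_iff.1 hsub) ?_ r)⟩, hnl⟩
      intro r c h1 h2
      exact hr (r, c) ⟨by simp; omega, h2⟩ (fun hc => by have := hc.2; simp at this; omega)
    · rintro ⟨hx, hnl⟩
      have hr : ∀ y ∈ diagram nu, y ∉ diagram lam → colRes h y.2 = i := by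
        rintro ⟨r, c⟩ ⟨h1, h2⟩ h3
        refine hres r c ?_ h2
        by_contra hc
        exact h3 ⟨h1, by simp; omega⟩
      exact ⟨hr _ hx hnl, hnl, nu, hs, diagram_sub_iff.2 hle, hx, hr⟩
  have hfin : (diagram nu).Finite := by
    obtain ⟨N, hN⟩ := exists_bound nu
    apply Set.Finite.subset ((Finset.range N ×ˢ Finset.range (nu.parts 0 + 1)).finite_toSet)
    rintro ⟨r, c⟩ ⟨h1, h2⟩
    simp only [Finset.coe_product, Finset.coe_range, Set.mem_prod, Set.mem_Iio]
    simp only at h1 h2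
    refine ⟨?_, ?_⟩
    · by_contra hc
      rw [hN r (by omega)] at h2
      omega
    · have := anti nu (Nat.zero_le r)
      omega
  have hafin : {x | Addable h i lam x}.Finite := by
    rw [hadd]; exact hfin.subset Set.diff_subset
  have hno : ∀ x, ¬ Normal h i lam x := fun x hx => hu x hx.1
  have hcon : ∀ x, Conormal h i lam x ↔ Addable h i lam x := by
    intro x
    refine ⟨fun hx => hx.1, fun hx => ⟨hx, fun z hz => ?_⟩⟩
    have e : {y | Removable h i lam y ∧ posLE x y ∧ posLE y z} = ∅ := by
      ext y; simp [hu y]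
    rw [e, Set.ncard_empty, Set.ncard_pos (hafin.subset (fun y hy => hy.1))]
    exact ⟨x, hx, Or.inr ⟨rfl, le_rfl⟩, hz⟩
  have hpsi : psiSet h i lam = diagram nu := by
    unfold psiSet
    have e0 : {x | Normal h i lam x} = ∅ := by ext y; simp [hno y]
    have e1 : {x | Conormal h i lam x} = {x | Addable h i lam x} := by ext y; simp [hcon y]
    rw [e0, Set.ncard_empty, if_pos (Nat.zero_le _), e1]
    have e2 : {x | Conormal h i lam x ∧ Set.ncard {y | Conormal h i lam y ∧ posLE y x} ≤
        Set.ncard {x | Addable h i lam x} - 0} = {x | Addable h i lam x} := by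
      ext x
      simp only [Set.mem_setOf_eq, hcon]
      refine ⟨fun hx => hx.1, fun hx => ⟨hx, ?_⟩⟩
      exact Set.ncard_le_ncard (fun y hy => hy.1) hafin
    rw [e2, hadd, Set.union_diff_self, Set.union_eq_right]
    exact diagram_sub_iff.2 hle
  have hex : ∃ mu : BPartition, diagram mu = psiSet h i lam := ⟨nu, hpsi.symm⟩
  unfold psi
  rw [dif_pos hex]
  exact diagram_inj (hex.choose_spec.trans hpsi)

/-- lowering one row -/
theorem removable_of_lower {h i : ℕ} {lam : BPartition} (hu : ∀ x, ¬ Removable h i lam x)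
    (hs : IsHStrict h lam) (r : ℕ) (hpos : 0 < lam.parts r) (hres : colRes h (lam.parts r) = i)
    (hlt : lam.parts (r + 1) < lam.parts r)
    (hok : lam.parts (r + 1) < lam.parts r - 1 ∨ (h ∣ lam.parts r - 1)) : False := by
  obtain ⟨N, hN⟩ := exists_bound lam
  obtain ⟨mu, hmu⟩ := exists_mk (fun s => if s = r then lam.parts r - 1 else lam.parts s)
    (by
      intro s
      have := lam.antitone s
      by_cases h1 : s + 1 = r
      · subst h1
        simp
        omega
      · by_cases h2 : s = r
        · subst h2
          simp
          omega
        · simpa [h1, h2] using this)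
    N (by
      intro s hs
      have := hN s hs
      by_cases h2 : s = r
      · subst h2; omega
      · simpa [h2] using this)
  apply hu (r, lam.parts r)
  refine ⟨⟨hpos, le_rfl⟩, mu, ?_, ?_, ?_, ?_⟩
  · intro s
    rw [hmu, hmu]
    by_cases h2 : s = r
    · subst h2
      simp
      rcases hok with hok | hok
      · left; exact hok
      · have := lam.antitone s
        rcases Nat.lt_or_ge (lam.parts (s + 1)) (lam.parts s - 1) with h3 | h3
        · left; exact h3
        · right
          rcases Nat.eq_zero_or_pos (lam.parts s - 1) with h4 | h4
          · right; omega
          · left; exact ⟨by omega, hok⟩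
    · by_cases h1 : s + 1 = r
      · subst h1
        have := lam.antitone s
        simp
        left
        omega
      · simpa [h1, h2] using hs s
  · apply diagram_sub_iff.2
    intro s
    rw [hmu]
    split_ifs with h1
    · subst h1; omega
    · exact le_rfl
  · intro hc
    have := hc.2
    rw [hmu] at this
    simp at this
    omega
  · rintro ⟨s, c⟩ ⟨h1, h2⟩ h3
    by_cases h4 : s = r
    · subst h4
      have : c = lam.parts s := by
        by_contra hne
        apply h3
        refine ⟨h1, ?_⟩
        rw [hmu]
        simp at h2 ⊢
        omega
      rw [← this] at hres
      exact hres
    · exfalso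
      apply h3
      refine ⟨h1, ?_⟩
      rw [hmu]
      simpa [h4] using h2

end BPartition

namespace BPartition

theorem not_dvd_small {h m : ℤ} (h1 : 0 < m) (h2 : m < h) : ¬ h ∣ m := fun hd =>
  absurd (Int.le_of_dvd h1 hd) (by omega)

/-- properties of the left predicate for i ≥ 1 -/
structure LProp (h : ℕ) (L : ℤ → Prop) : Prop where
  add : ∀ z, L z → L (z + h)
  sub : ∀ z, L z → L (z - h)
  mir : ∀ z, L z → L (-1 - z)
  succ : ∀ z, L z → ¬ L (z + 1)
  nd : ∀ z, L z → ¬ (h : ℤ) ∣ z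
  nd' : ∀ z, L z → ¬ (h : ℤ) ∣ z + 1

theorem dvd_eq' {a b c : ℤ} (h : a ∣ b) (e : b = c) : a ∣ c := e ▸ h

theorem LProp_LL {n h i : ℕ} (hh : h = 2 * n + 1) (hi : i ≤ n) (hi1 : 1 ≤ i) :
    LProp h (LL h i) := by
  constructor
  · rintro z (hz | hz)
    · left
      have := dvd_add hz (dvd_refl (h : ℤ))
      exact dvd_eq' this (by ring)
    · right
      have := dvd_add hz (dvd_refl (h : ℤ))
      exact dvd_eq' this (by ring)
  · rintro z (hz | hz)
    · left
      have := dvd_sub hz (dvd_refl (h : ℤ))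
      exact dvd_eq' this (by ring)
    · right
      have := dvd_sub hz (dvd_refl (h : ℤ))
      exact dvd_eq' this (by ring)
  · rintro z (hz | hz)
    · right
      have := (dvd_neg (a := (h : ℤ))).2 hz
      exact dvd_eq' this (by ring)
    · left
      have := (dvd_neg (a := (h : ℤ))).2 hz
      exact dvd_eq' this (by ring)
  · rintro z (hz | hz) (hw | hw)
    · have := dvd_sub hw hz
      exact not_dvd_small (h := h) (m := 1) (by omega) (by omega) (by exact dvd_eq' this (by ring))
    · have h2 := dvd_sub hw hz
      have h3 : (h : ℤ) ∣ (2 * i + 2 : ℤ) := by exact dvd_eq' h2 (by ring)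
      have h4 := dvd_sub (dvd_refl (h : ℤ)) h3
      have h5 := Int.le_of_dvd (by omega) h3
      rcases eq_or_ne (i : ℕ) n with h6 | h6
      · exact not_dvd_small (h := h) (m := 1) (by omega) (by omega)
          (by have := (dvd_neg (a := (h : ℤ))).2 h4; exact dvd_eq' this (by omega))
      · omega
    · have h2 := dvd_sub hz hw
      exact not_dvd_small (h := h) (m := 2 * i) (by omega) (by omega) (by exact dvd_eq' h2 (by ring))
    · have := dvd_sub hw hz
      exact not_dvd_small (h := h) (m := 1) (by omega) (by omega) (by exact dvd_eq' this (by ring))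
  · rintro z (hz | hz) hw
    · have h2 := dvd_sub hw hz
      exact not_dvd_small (h := h) (m := i) (by omega) (by omega) (by exact dvd_eq' h2 (by ring))
    · have h2 := dvd_sub hz hw
      exact not_dvd_small (h := h) (m := i + 1) (by omega) (by omega) (by exact dvd_eq' h2 (by ring))
  · rintro z (hz | hz) hw
    · have h2 := dvd_sub hw hz
      exact not_dvd_small (h := h) (m := i + 1) (by omega) (by omega) (by exact dvd_eq' h2 (by ring))
    · have h2 := dvd_sub hz hw
      exact not_dvd_small (h := h) (m := i) (by omega) (by omega) (by exact dvd_eq' h2 (by ring))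

open Classical in
/-- swap for i ≥ 1 -/
noncomputable def sw (L : ℤ → Prop) (p : ℕ) : ℕ :=
  if L p then p + 1 else if L ((p : ℤ) - 1) then p - 1 else p

theorem hstrict_lt' {h : ℕ} {lam : BPartition} (hs : IsHStrict h lam) {r s : ℕ} (hrs : r < s)
    (hnd : ¬ (h : ℤ) ∣ (lam.parts r : ℤ)) : lam.parts s < lam.parts r :=
  hstrict_lt hs hrs (fun hc => hnd (by exact_mod_cast hc))

/-- rows of an i-extension -/
theorem row_ext {n h i : ℕ} (hh : h = 2 * n + 1) (hi : i ≤ n) (hi1 : 1 ≤ i)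
    {lam nu : BPartition} (hs : IsHStrict h nu) (hle : ∀ r, lam.parts r ≤ nu.parts r)
    (hres : ∀ r c, lam.parts r < c → c ≤ nu.parts r → colRes h c = i) (r : ℕ) :
    nu.parts r = lam.parts r ∨ (nu.parts r = lam.parts r + 1 ∧ LL h i (lam.parts r) ∧
      ∀ q, lam.parts q ≠ lam.parts r + 1) := by
  have LP := LProp_LL hh hi hi1
  have key : ∀ r, lam.parts r < nu.parts r →
      nu.parts r = lam.parts r + 1 ∧ LL h i (lam.parts r) := by
    intro r hr
    have h1 := hres r (lam.parts r + 1) (by omega) (by omega)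
    rw [colRes_iff hh hi (by omega)] at h1
    have h1' : LL h i (lam.parts r) := by simpa using h1
    refine ⟨?_, h1'⟩
    by_contra hne
    have h2 := hres r (lam.parts r + 2) (by omega) (by have := hle r; omega)
    rw [colRes_iff hh hi (by omega)] at h2
    apply LP.succ _ h1'
    convert h2 using 1
    push_cast; ring
  rcases Nat.lt_or_ge (lam.parts r) (nu.parts r) with hr | hr
  · right
    obtain ⟨h1, h2⟩ := key r hr
    refine ⟨h1, h2, fun q hq => ?_⟩
    have hqr : q < r := by
      by_contra hc
      have := anti lam (show r ≤ q by omega)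
      omega
    have h3 : nu.parts q = lam.parts q := by
      by_contra hne
      have h4 := (key q (lt_of_le_of_ne (hle q) (Ne.symm hne))).2
      rw [hq] at h4
      exact LP.succ _ h2 (by exact_mod_cast h4)
    have h5 := hstrict_lt' hs hqr (by
      rw [h3, hq]; exact_mod_cast LP.nd' _ h2)
    omega
  · left
    exact le_antisymm hr (hle r)

theorem next_of_right {n h i : ℕ} (hh : h = 2 * n + 1) (hi : i ≤ n) (hi1 : 1 ≤ i)
    {lam : BPartition} (hs : IsHStrict h lam) (hu : ∀ x, ¬ Removable h i lam x) (r : ℕ)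
    (hr : LL h i ((lam.parts r : ℤ) - 1)) : lam.parts (r + 1) + 1 = lam.parts r := by
  have LP := LProp_LL hh hi hi1
  have hpos : 0 < lam.parts r := by
    rcases Nat.eq_zero_or_pos (lam.parts r) with h0 | h0
    · rw [h0] at hr
      exfalso
      apply LP.nd' _ hr
      simp
    · exact h0
  have hlt := hstrict_lt' hs (Nat.lt_succ_self r) (by
    have := LP.nd' _ hr; simpa using this)
  by_contra hne
  exact removable_of_lower hu hs r hpos ((colRes_iff hh hi hpos).2 hr) hlt
    (Or.inl (by simp at hlt; omega))

theorem FF_psi {n h i : ℕ} (hh : h = 2 * n + 1) (hi : i ≤ n) (hi1 : 1 ≤ i)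
    {lam : BPartition} (hs : IsHStrict h lam) (hu : ∀ x, ¬ Removable h i lam x) (x : ℕ) :
    FF (fun p => p - x) (psi h i lam) = FF (fun p => sw (LL h i) p - x) lam := by
  classical
  have LP := LProp_LL hh hi hi1
  have nxt := next_of_right hh hi hi1 hs hu
  obtain ⟨N, hN⟩ := exists_bound lam
  have L0 : ¬ LL h i ((0 : ℕ) : ℤ) := fun hc => LP.nd _ hc (by simp)
  have L1 : ¬ LL h i (((0 : ℕ) : ℤ) - 1) := fun hc => LP.nd' _ hc (by simp)
  have hlt : ∀ r s, r < s → LL h i (lam.parts r) → lam.parts s < lam.parts r :=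
    fun r s hrs hL => hstrict_lt' hs hrs (LP.nd _ hL)
  have hlt' : ∀ r s, r < s → LL h i (lam.parts s) → lam.parts s < lam.parts r := by
    intro r s hrs hL
    refine lt_of_le_of_ne (anti lam hrs.le) (fun he => ?_)
    have := hlt r s hrs (he ▸ hL)
    omega
  obtain ⟨nu, hnu⟩ := exists_mk (fun r => if LL h i (lam.parts r) ∧
      (∀ q, lam.parts q ≠ lam.parts r + 1) then lam.parts r + 1 else lam.parts r)
    (by
      intro r
      have h1 := lam.antitone r
      have h2 := hlt' r (r + 1) (Nat.lt_succ_self r)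
      split_ifs with h3 h4 h4
      · omega
      · have := h2 h3.1; omega
      · omega
      · omega)
    N (by
      intro r hr
      rw [hN r hr, if_neg (fun hc => L0 hc.1)])
  have hpsi : psi h i lam = nu := by
    apply psi_eq hu
    · intro r
      rw [hnu, hnu]
      have h1 := hs r
      have h2 := hlt' r (r + 1) (Nat.lt_succ_self r)
      have h5 := hlt r (r + 1) (Nat.lt_succ_self r)
      split_ifs with h3 h4 h4
      · have := h2 h3.1; omega
      · have := h2 h3.1
        have := h3.2 r
        omega
      · have := h5 h4.1
        omega
      · exact h1
    · intro r
      rw [hnu]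
      split_ifs <;> omega
    · intro r c h1 h2
      rw [hnu] at h2
      split_ifs at h2 with h3
      · rw [colRes_iff hh hi (by omega), show c = lam.parts r + 1 by omega]
        simpa using h3.1
      · omega
    · intro nu' hs' hle' hres' r
      rw [hnu]
      rcases row_ext hh hi hi1 hs' hle' hres' r with h1 | ⟨h1, h2⟩
      · split_ifs <;> omega
      · rw [if_pos h2]; omega
  rw [hpsi]
  have hN' : ∀ r, N + 1 ≤ r → nu.parts r = 0 := by
    intro r hr
    rw [hnu, hN r (by omega), if_neg (fun hc => L0 hc.1)]
  have sw0 : sw (LL h i) 0 = 0 := by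
    unfold sw
    rw [if_neg L0, if_neg L1]
  rw [FF_eq _ (by simp) nu (N + 1) hN', FF_eq _ (by simp [sw0]) lam (N + 1)
    (fun r hr => hN r (by omega))]
  set T : ℕ → ℕ := fun m => if ∃ q, m = q + 1 ∧ LL h i ((lam.parts q : ℤ) - 1) then
    (lam.parts (m - 1) - x) - (lam.parts (m - 1) - 1 - x) else 0 with hT
  have key : ∀ m, ∑ r ∈ Finset.range m, (nu.parts r - x)
      = ∑ r ∈ Finset.range m, (sw (LL h i) (lam.parts r) - x) + T m := by
    intro m
    induction m with
    | zero => simp [hT]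
    | succ m ih =>
      rw [Finset.sum_range_succ, Finset.sum_range_succ, ih]
      have hTs : T (m + 1) = if LL h i ((lam.parts m : ℤ) - 1) then
          (lam.parts m - x) - (lam.parts m - 1 - x) else 0 := by
        simp only [hT]
        simp
      suffices hsuf : nu.parts m - x + T m = sw (LL h i) (lam.parts m) - x + T (m + 1) by omega
      rw [hTs, hnu]
      have hTm : T m = 0 ∨ (LL h i (lam.parts m) ∧ ∃ q, lam.parts q = lam.parts m + 1 ∧
          T m = (lam.parts m + 1 - x) - (lam.parts m - x)) := by
        by_cases hc : ∃ q, m = q + 1 ∧ LL h i ((lam.parts q : ℤ) - 1)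
        · right
          obtain ⟨q, rfl, hq⟩ := hc
          have h1 := nxt q hq
          refine ⟨?_, q, h1.symm, ?_⟩
          · convert hq using 1
            omega
          · simp only [hT]
            rw [if_pos ⟨q, rfl, hq⟩]
            simp only [Nat.add_sub_cancel]
            omega
        · left
          simp only [hT]
          rw [if_neg hc]
      unfold sw
      by_cases hL : LL h i (lam.parts m)
      · have hL' : ¬ LL h i ((lam.parts m : ℤ) - 1) := fun hc =>
          LP.succ _ hc (by simpa using hL)
        rw [if_pos hL, if_neg hL']
        by_cases hq : ∀ q, lam.parts q ≠ lam.parts m + 1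
        · rw [if_pos ⟨hL, hq⟩]
          rcases hTm with h0 | ⟨_, q, h1, _⟩
          · omega
          · exact absurd h1 (hq q)
        · rw [if_neg (fun hc => hq hc.2)]
          push Not at hq
          obtain ⟨q, hq⟩ := hq
          have hqL : LL h i ((lam.parts q : ℤ) - 1) := by
            rw [hq]; simpa using hL
          have h1 := nxt q hqL
          have hqm : m = q + 1 := by
            by_contra hne
            rcases Nat.lt_or_gt_of_ne hne with h2 | h2
            · have := anti lam (show m ≤ q by omega)
              omega
            · have := hlt' _ _ h2 hL
              omega
          have hTe : T m = (lam.parts m + 1 - x) - (lam.parts m - x) := by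
            simp only [hT]
            rw [if_pos ⟨q, hqm, hqL⟩]
            subst hqm
            simp only [Nat.add_sub_cancel]
            omega
          omega
      · rw [if_neg hL, if_neg (fun hc => hL hc.1)]
        have h0 : T m = 0 := by
          rcases hTm with h0 | h0
          · exact h0
          · exact absurd h0.1 hL
        rw [h0]
        split_ifs <;> omega
  rw [key]
  have : T (N + 1) = 0 := by
    simp only [hT]
    rw [if_neg]
    rintro ⟨q, h1, h2⟩
    rw [show q = N by omega, hN N le_rfl] at h2
    exact L1 h2
  omega

open Classical in
/-- swap for i = 0 -/
noncomputable def sw0 (h : ℕ) (p : ℕ) : ℕ := if h ∣ p + 1 then p + 2 else p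

theorem colRes_zero_iff {n h c : ℕ} (hh : h = 2 * n + 1) :
    colRes h (c + 1) = 0 ↔ h ∣ c ∨ h ∣ c + 1 := by
  rw [colRes_iff hh (Nat.zero_le n) (by omega)]
  unfold LL
  push_cast
  simp only [add_sub_cancel_right, sub_zero, add_zero]
  constructor
  · rintro (h1 | h1)
    · left; exact_mod_cast h1
    · right; exact_mod_cast h1
  · rintro (h1 | h1)
    · left; exact_mod_cast h1
    · right; exact_mod_cast h1

theorem nat_ndvd {h a b : ℕ} (h1 : a < b) (h2 : b < a + h) (ha : h ∣ a) : ¬ h ∣ b := by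
  intro hb
  have := Nat.le_of_dvd (by omega) (Nat.dvd_sub hb ha)
  omega

theorem no_one {n h : ℕ} (hh : h = 2 * n + 1) (hn : 1 ≤ n) {lam : BPartition}
    (hs : IsHStrict h lam) (hu : ∀ x, ¬ Removable h 0 lam x) (r p : ℕ)
    (hr : lam.parts r = p + 1) : ¬ h ∣ p := by
  intro hp
  have hlt := hstrict_lt hs (Nat.lt_succ_self r) (by
    rw [hr]; exact nat_ndvd (by omega) (by omega) hp)
  exact removable_of_lower hu hs r (by omega) (by
    rw [hr, colRes_zero_iff hh]; left; exact hp) hlt (Or.inr (by simpa [hr] using hp))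

theorem next_zero {n h : ℕ} (hh : h = 2 * n + 1) {lam : BPartition}
    (hs : IsHStrict h lam) (hu : ∀ x, ¬ Removable h 0 lam x) (r : ℕ)
    (hr : h ∣ lam.parts r) : lam.parts (r + 1) = lam.parts r ∨
      lam.parts (r + 1) + 1 = lam.parts r := by
  by_contra hc
  push Not at hc
  have h1 := lam.antitone r
  refine removable_of_lower hu hs r (by omega) ?_ (by omega) (Or.inl (by omega))
  obtain ⟨p, hp⟩ : ∃ p, lam.parts r = p + 1 := ⟨lam.parts r - 1, by omega⟩
  rw [hp, colRes_zero_iff hh]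
  right
  rw [← hp]; exact hr

theorem FF_psi0 {n h : ℕ} (hh : h = 2 * n + 1) (hn : 1 ≤ n)
    {lam : BPartition} (hs : IsHStrict h lam) (hu : ∀ x, ¬ Removable h 0 lam x) (x : ℕ) :
    FF (fun p => p - x) (psi h 0 lam) = FF (fun p => sw0 h p - x) lam + (1 - x) := by
  classical
  have no1 := no_one hh hn hs hu
  have nxt := next_zero hh hs hu
  obtain ⟨N, hN⟩ := exists_bound lam
  have h1nd : ¬ h ∣ 1 := nat_ndvd (a := 0) (by omega) (by omega) (dvd_zero h)
  set P : ℕ → ℕ → Prop := fun r p => ∃ q, r = q + 1 ∧ lam.parts q = p with hP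
  set f : ℕ → ℕ := fun r => if h ∣ lam.parts r + 1 then
      (if P r (lam.parts r + 1) then lam.parts r + 1 else lam.parts r + 2)
    else if h ∣ lam.parts r then
      (if P r (lam.parts r) then lam.parts r else lam.parts r + 1) else lam.parts r with hf
  have f1 : ∀ r, h ∣ lam.parts r + 1 → P r (lam.parts r + 1) → f r = lam.parts r + 1 := by
    intro r h1 h2; simp only [hf]; rw [if_pos h1, if_pos h2]
  have f2 : ∀ r, h ∣ lam.parts r + 1 → ¬ P r (lam.parts r + 1) → f r = lam.parts r + 2 := by
    intro r h1 h2; simp only [hf]; rw [if_pos h1, if_neg h2]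
  have f3 : ∀ r, h ∣ lam.parts r → P r (lam.parts r) → f r = lam.parts r := by
    intro r h1 h2; simp only [hf]
    rw [if_neg (nat_ndvd (by omega) (by omega) h1), if_pos h1, if_pos h2]
  have f4 : ∀ r, h ∣ lam.parts r → ¬ P r (lam.parts r) → f r = lam.parts r + 1 := by
    intro r h1 h2; simp only [hf]
    rw [if_neg (nat_ndvd (by omega) (by omega) h1), if_pos h1, if_neg h2]
  have f5 : ∀ r, ¬ h ∣ lam.parts r + 1 → ¬ h ∣ lam.parts r → f r = lam.parts r := by
    intro r h1 h2; simp only [hf]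
    rw [if_neg h1, if_neg h2]
  have fge : ∀ r, lam.parts r ≤ f r := by
    intro r
    simp only [hf]
    split_ifs <;> omega
  have fstep : ∀ r, f (r + 1) < f r ∨ (f (r + 1) = f r ∧ h ∣ f r) := by
    intro r
    have h1 := lam.antitone r
    have hge := fge r
    by_cases ha : h ∣ lam.parts (r + 1) + 1
    · have hne : lam.parts (r + 1) ≠ lam.parts r := by
        intro he
        have := hstrict_lt hs (Nat.lt_succ_self r) (by
          rw [← he]; exact fun hc => nat_ndvd (b := lam.parts (r + 1) + 1) (by omega) (by omega) hc ha)
        simp at this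
        omega
      by_cases hb : lam.parts r = lam.parts (r + 1) + 1
      · rw [f1 (r + 1) ha ⟨r, rfl, hb⟩, ← hb]
        rw [← hb] at ha
        by_cases hp : P r (lam.parts r)
        · rw [f3 r ha hp]; right; exact ⟨rfl, ha⟩
        · rw [f4 r ha hp]; left; omega
      · have hc : lam.parts r ≠ (lam.parts (r + 1) + 1) + 1 := fun hc => no1 r _ hc ha
        left
        have : f (r + 1) = lam.parts (r + 1) + 2 := by
          apply f2 _ ha
          rintro ⟨q, hq1, hq2⟩
          obtain rfl : q = r := by omega
          exact hb hq2
        omega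
    · by_cases hd : h ∣ lam.parts (r + 1)
      · by_cases hb : lam.parts r = lam.parts (r + 1)
        · rw [f3 (r + 1) hd ⟨r, rfl, hb⟩, ← hb]
          rw [← hb] at hd
          by_cases hp : P r (lam.parts r)
          · rw [f3 r hd hp]; right; exact ⟨rfl, hd⟩
          · rw [f4 r hd hp]; left; omega
        · have hc : lam.parts r ≠ (lam.parts (r + 1)) + 1 := fun hc => no1 r _ hc hd
          left
          have : f (r + 1) = lam.parts (r + 1) + 1 := by
            apply f4 _ hd
            rintro ⟨q, hq1, hq2⟩
            obtain rfl : q = r := by omega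
            exact hb hq2
          omega
      · rw [f5 (r + 1) ha hd]
        left
        have hne : lam.parts (r + 1) ≠ lam.parts r := by
          intro he
          have := hstrict_lt hs (Nat.lt_succ_self r) (by rw [← he]; exact hd)
          simp at this
          omega
        omega
  have fz : ∀ r, N + 1 ≤ r → f r = 0 := by
    intro r hr
    have h0 : lam.parts r = 0 := hN r (by omega)
    rw [f3 r (by rw [h0]; exact dvd_zero h) ⟨r - 1, by omega, by rw [h0]; exact hN _ (by omega)⟩, h0]
  obtain ⟨nu, hnu⟩ := exists_mk f (fun r => by have := fstep r; omega) (N + 1) fz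
  have hpsi : psi h 0 lam = nu := by
    apply psi_eq hu
    · intro r
      rw [hnu, hnu]
      rcases fstep r with h1 | ⟨h1, h2⟩
      · left; exact h1
      · right
        rcases Nat.eq_zero_or_pos (f r) with h3 | h3
        · right; exact h3
        · left; exact ⟨h3, h2⟩
    · intro r
      rw [hnu]
      exact fge r
    · intro r c h1 h2
      rw [hnu] at h2
      obtain ⟨d, rfl⟩ : ∃ d, c = d + 1 := ⟨c - 1, by omega⟩
      rw [colRes_zero_iff hh]
      simp only [hf] at h2
      split_ifs at h2 with h3 h4 h4 h5
      · right; rwa [show d = lam.parts r by omega]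
      · rcases (show d = lam.parts r ∨ d = lam.parts r + 1 by omega) with rfl | rfl
        · right; exact h3
        · left; exact h3
      · omega
      · left; rwa [show d = lam.parts r by omega]
      · omega
    · intro nu' hs' hle' hres' r
      rw [hnu]
      have hadd : ∀ r d, lam.parts r ≤ d → d + 1 ≤ nu'.parts r → h ∣ d ∨ h ∣ d + 1 := by
        intro r d h1 h2
        exact (colRes_zero_iff hh).1 (hres' r (d + 1) (by omega) h2)
      have hle := hle' r
      by_cases ha : h ∣ lam.parts r + 1
      · have hb : nu'.parts r ≤ lam.parts r + 2 := by
          by_contra hc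
          rcases hadd r (lam.parts r + 2) (by omega) (by omega) with h1 | h1
          · exact nat_ndvd (by omega) (by omega) ha h1
          · exact nat_ndvd (by omega) (by omega) ha h1
        by_cases hp : P r (lam.parts r + 1)
        · rw [f1 r ha hp]
          obtain ⟨q, rfl, hq⟩ := hp
          by_contra hc
          have hqle : nu'.parts q ≤ lam.parts q + 1 := by
            by_contra hc
            rw [← hq] at ha
            rcases hadd q (lam.parts q + 1) (by omega) (by omega) with h1 | h1
            · exact nat_ndvd (by omega) (by omega) ha h1
            · exact nat_ndvd (by omega) (by omega) ha h1
          have h3 := nu'.antitone q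
          have h4 := hstrict_lt hs' (Nat.lt_succ_self q) (by
            rw [show nu'.parts q = lam.parts (q + 1) + 1 + 1 by omega]
            exact nat_ndvd (by omega) (by omega) ha)
          simp at h4
          omega
        · rw [f2 r ha hp]; exact hb
      · by_cases hd : h ∣ lam.parts r
        · have hb : ∀ s, lam.parts s = lam.parts r → nu'.parts s ≤ lam.parts r + 1 := by
            intro s hsr
            by_contra hc
            rcases hadd s (lam.parts r + 1) (by omega) (by omega) with h1 | h1
            · exact nat_ndvd (by omega) (by omega) hd h1
            · exact nat_ndvd (by omega) (by omega) hd h1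
          by_cases hp : P r (lam.parts r)
          · rw [f3 r hd hp]
            obtain ⟨q, rfl, hq⟩ := hp
            by_contra hc
            have h2 := hb q hq
            have h3 := nu'.antitone q
            have h4 := hstrict_lt hs' (Nat.lt_succ_self q) (by
              rw [show nu'.parts q = lam.parts (q + 1) + 1 by omega]
              exact nat_ndvd (by omega) (by omega) hd)
            simp at h4
            omega
          · rw [f4 r hd hp]; exact hb r rfl
        · rw [f5 r ha hd]
          by_contra hc
          rcases hadd r (lam.parts r) (by omega) (by omega) with h1 | h1
          · exact hd h1
          · exact ha h1
  rw [hpsi]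
  have s0 : sw0 h 0 = 0 := by
    unfold sw0
    rw [if_neg (by simpa using h1nd)]
  rw [FF_eq _ (by simp) nu (N + 1) (fun r hr => by rw [hnu]; exact fz r hr),
    FF_eq _ (by simp [s0]) lam (N + 1) (fun r hr => hN r (by omega))]
  set T : ℕ → ℕ := fun m => if ∃ q, m = q + 1 ∧ h ∣ lam.parts q then
    (lam.parts (m - 1) + 1 - x) - (lam.parts (m - 1) - x) else 0 with hT
  have key : ∀ m, ∑ r ∈ Finset.range m, (nu.parts r - x)
      = ∑ r ∈ Finset.range m, (sw0 h (lam.parts r) - x) + T m := by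
    intro m
    induction m with
    | zero => simp [hT]
    | succ m ih =>
      rw [Finset.sum_range_succ, Finset.sum_range_succ, ih]
      have hTs : T (m + 1) = if h ∣ lam.parts m then
          (lam.parts m + 1 - x) - (lam.parts m - x) else 0 := by
        simp only [hT]
        simp
      suffices hsuf : nu.parts m - x + T m = sw0 h (lam.parts m) - x + T (m + 1) by omega
      rw [hTs, hnu]
      have hTm : T m = 0 ∨ ∃ q, m = q + 1 ∧ h ∣ lam.parts q := by
        by_cases hc : ∃ q, m = q + 1 ∧ h ∣ lam.parts q
        · right; exact hc
        · left; simp only [hT]; rw [if_neg hc]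
      unfold sw0
      by_cases ha : h ∣ lam.parts m + 1
      · have ha' : ¬ h ∣ lam.parts m := fun hc =>
          nat_ndvd (b := lam.parts m + 1) (by omega) (by omega) hc ha
        rw [if_pos ha, if_neg ha']
        by_cases hp : P m (lam.parts m + 1)
        · rw [f1 m ha hp]
          obtain ⟨q, rfl, hq⟩ := hp
          have : T (q + 1) = (lam.parts q + 1 - x) - (lam.parts q - x) := by
            simp only [hT]
            rw [if_pos ⟨q, rfl, by rw [hq]; exact ha⟩]
            simp
          omega
        · rw [f2 m ha hp]
          rcases hTm with h0 | ⟨q, rfl, hq⟩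
          · omega
          · exfalso
            rcases nxt q hq with h2 | h2
            · rw [h2] at ha'; exact ha' hq
            · exact hp ⟨q, rfl, h2.symm⟩
      · rw [if_neg ha]
        by_cases hd : h ∣ lam.parts m
        · rw [if_pos hd]
          by_cases hp : P m (lam.parts m)
          · rw [f3 m hd hp]
            obtain ⟨q, rfl, hq⟩ := hp
            have : T (q + 1) = (lam.parts q + 1 - x) - (lam.parts q - x) := by
              simp only [hT]
              rw [if_pos ⟨q, rfl, by rw [hq]; exact hd⟩]
              simp
            omega
          · rw [f4 m hd hp]
            rcases hTm with h0 | ⟨q, rfl, hq⟩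
            · omega
            · exfalso
              rcases nxt q hq with h2 | h2
              · exact hp ⟨q, rfl, h2.symm⟩
              · rw [← h2] at hq; exact ha hq
        · rw [if_neg hd, f5 m ha hd]
          rcases hTm with h0 | ⟨q, rfl, hq⟩
          · omega
          · exfalso
            rcases nxt q hq with h2 | h2
            · rw [h2] at hd; exact hd hq
            · rw [← h2] at hq; exact ha hq
  rw [key]
  have : T (N + 1) = 1 - x := by
    simp only [hT]
    rw [if_pos ⟨N, rfl, by rw [hN N le_rfl]; exact dvd_zero h⟩]
    simp [hN N le_rfl]
  omega

end BPartition

namespace BPartition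

/-- contribution of a bar at position c -/
def gg (h c x : ℕ) : ℕ := if h ≤ c then (c - x) - (c - h - x) else (c - x) + (h - c - x)

theorem dom_char {n h : ℕ} (hh : h = 2 * n + 1) {u v u' v' : ℕ} (hu : n < u) (huv : u ≤ v)
    (hu' : n < u') (huv' : u' ≤ v') :
    (∀ x, gg h u x + gg h v x ≤ gg h u' x + gg h v' x) ↔
      (u ≤ u' ∧ v ≤ v') ∨ (u' < u ∧ u + v ≤ 2 * h ∧ u + v ≤ u' + v') := by
  constructor
  · intro H
    by_contra hc
    push Not at hc
    obtain ⟨hc1, hc2⟩ := hc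
    by_cases h1 : v' < v
    · have := H (v - 1)
      unfold gg at this
      split_ifs at this <;> omega
    · have h2 : u' < u := by
        by_contra h2
        have := hc1 (by omega)
        omega
      have hc3 := hc2 h2
      by_cases h3 : h ≤ u'
      · have := H (u' - h + 1)
        unfold gg at this
        split_ifs at this <;> omega
      · by_cases h4 : u + v ≤ 2 * h
        · have := H (h - u')
          have := hc3 h4
          unfold gg at *
          split_ifs at * <;> omega
        · have := H (max 1 (h - u + 1))
          unfold gg at this
          split_ifs at this <;> omega
  · intro H x
    unfold gg
    rcases H with H | H
    · split_ifs <;> omega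
    · split_ifs <;> omega

end BPartition

namespace BPartition

theorem FF_erase (φ : ℕ → ℕ) (M : Multiset ℕ) (a : ℕ) (ha : a ∈ M) :
    (M.map φ).sum = φ a + ((M.erase a).map φ).sum := by
  conv_lhs => rw [← Multiset.cons_erase ha]
  rw [Multiset.map_cons, Multiset.sum_cons]

theorem step_FF {n h : ℕ} (hh : h = 2 * n + 1) {lam nu : BPartition} {v : ℕ}
    (st : barStepRec h lam nu v) (φ : ℕ → ℕ) (hφ : φ 0 = 0) :
    n < v ∧ ((h ≤ v ∧ FF φ lam + φ (v - h) = FF φ nu + φ v) ∨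
      (v < h ∧ FF φ lam = FF φ nu + φ v + φ (h - v))) := by
  unfold FF
  obtain ⟨-, ⟨h1, h2, h3⟩ | ⟨h1, h2, h3⟩ | ⟨a, b, h1, h2, h3, h4, h5⟩⟩ := st
  · refine ⟨by omega, Or.inl ⟨by omega, ?_⟩⟩
    rw [h3, FF_erase φ _ _ h2, h1]
    simp [hφ]; omega
  · refine ⟨by omega, Or.inl ⟨by omega, ?_⟩⟩
    rw [h3, FF_erase φ _ _ h2]
    simp; omega
  · have ha := (mem_partsM.1 h2).1
    have hb := (mem_partsM.1 (Multiset.mem_of_mem_erase h3)).1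
    refine ⟨by omega, Or.inr ⟨by omega, ?_⟩⟩
    rw [h5, FF_erase φ _ _ h2, FF_erase φ _ _ h3]
    rcases Nat.le_total a b with h6 | h6
    · rw [show v = b by omega, show h - b = a by omega]; omega
    · rw [show v = a by omega, show h - a = b by omega]; omega

/-- one bar removal in terms of membership -/
theorem step_mem {n h : ℕ} (hh : h = 2 * n + 1) {lam nu : BPartition} {v : ℕ}
    (hs : IsHStrict h lam) (st : barStepRec h lam nu v) :
    (h ∣ v → (v = h ∨ v - h ∈ partsM nu)) ∧ (h ≤ v → v ∈ partsM lam) ∧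
    (∀ x, h ∣ x → x ∈ partsM lam → x ∈ partsM nu ∨ x = v) ∧
    (h ∣ v → ∀ x, ¬ h ∣ x → (x ∈ partsM lam ↔ x ∈ partsM nu)) ∧
    (¬ h ∣ v → h < v → (v - h ∈ partsM nu ∧ v ∉ partsM nu ∧
      ∀ x, ¬ h ∣ x → (x ∈ partsM lam ↔ (x ∈ partsM nu ∧ x ≠ v - h) ∨ x = v))) ∧
    (v < h → (v ∉ partsM nu ∧ h - v ∉ partsM nu ∧
      ∀ x, ¬ h ∣ x → (x ∈ partsM lam ↔ x ∈ partsM nu ∨ x = v ∨ x = h - v))) := by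
  have hs' := (hstrict_iff _ _).1 hs
  have hn' := (hstrict_iff _ _).1 st.1
  have er : ∀ (M : Multiset ℕ) (a x : ℕ), x ≠ a → (x ∈ M.erase a ↔ x ∈ M) :=
    fun M a x hx => Multiset.mem_erase_of_ne hx
  have er1 : ∀ (M : Multiset ℕ) (a : ℕ), M.count a ≤ 1 → a ∉ M.erase a := by
    intro M a h1 h2
    have := Multiset.count_pos.2 h2
    rw [Multiset.count_erase_self] at this
    omega
  obtain ⟨-, ⟨h1, h2, h3⟩ | ⟨h1, h2, h3⟩ | ⟨a, b, h1, h2, h3, h4, h5⟩⟩ := st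
  · refine ⟨fun _ => Or.inl h1, fun _ => h2, ?_, ?_, ?_, ?_⟩
    · intro x _ hx
      by_cases hv : x = v
      · exact Or.inr hv
      · left; rw [h3, er _ _ _ hv]; exact hx
    · intro hv x hx
      rw [h3, er _ _ _ (show x ≠ v from fun hc => hx (hc ▸ hv))]
    · intro hv; exact absurd (h1 ▸ dvd_refl v) hv
    · intro hv; omega
  · refine ⟨fun _ => Or.inr (by rw [h3]; simp), fun _ => h2, ?_, ?_, ?_, ?_⟩
    · intro x _ hx
      by_cases hv : x = v
      · exact Or.inr hv
      · left; rw [h3, Multiset.mem_cons, er _ _ _ hv]; exact Or.inr hx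
    · intro hv x hx
      have h4 : h ∣ v - h := Nat.dvd_sub hv (dvd_refl h)
      rw [h3, Multiset.mem_cons, er _ _ _ (show x ≠ v from fun hc => hx (hc ▸ hv))]
      constructor
      · exact Or.inr
      · rintro (h5 | h5)
        · exact absurd (h5 ▸ h4) hx
        · exact h5
    · intro hv _
      have hvm : v - h ≠ v := by omega
      have hvh : ¬ h ∣ v - h := by
        intro hc
        apply hv
        have := Nat.dvd_add hc (dvd_refl h)
        rwa [Nat.sub_add_cancel h1.le] at this
      have hv1 : v ∉ (partsM lam).erase v := er1 _ _ (hs' v hv)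
      have hv2 : v - h ∉ (partsM lam).erase v := by
        have := hn' _ hvh
        rw [h3, Multiset.count_cons_self] at this
        rw [← Multiset.count_eq_zero]
        omega
      refine ⟨by rw [h3]; simp, ?_, ?_⟩
      · rw [h3, Multiset.mem_cons]
        rintro (h4 | h4)
        · omega
        · exact hv1 h4
      · intro x hx
        rw [h3, Multiset.mem_cons]
        by_cases hxv : x = v
        · subst hxv; simp [h2]
        · rw [er _ _ _ hxv]
          by_cases hxw : x = v - h
          · rw [er _ _ _ hvm] at hv2
            subst hxw; simp [hv2]; omega
          · simp [hxw, hxv]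
    · intro hv; omega
  · have ha := (mem_partsM.1 h2).1
    have hb := (mem_partsM.1 (Multiset.mem_of_mem_erase h3)).1
    have hab : a ≠ b := by omega
    have nd : ∀ x, 0 < x → x < h → ¬ h ∣ x := fun x h1 h2 hc => by
      have := Nat.le_of_dvd h1 hc; omega
    have hbl := Multiset.mem_of_mem_erase h3
    have na : a ∉ partsM nu := by
      rw [h5, er _ _ _ hab]
      exact er1 _ _ (hs' a (nd a ha (by omega)))
    have nb : b ∉ partsM nu := by
      rw [h5]
      apply er1
      rw [Multiset.count_erase_of_ne hab.symm]
      exact hs' b (nd b hb (by omega))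
    have hm : ∀ x, x ∈ partsM lam ↔ x ∈ partsM nu ∨ x = a ∨ x = b := by
      intro x
      by_cases hxa : x = a
      · subst hxa; simp [h2]
      · by_cases hxb : x = b
        · subst hxb; simp [hbl]
        · rw [h5, er _ _ _ hxb, er _ _ _ hxa]; simp [hxa, hxb]
    have hvlt : v < h := by omega
    have hvp : 0 < v := by omega
    refine ⟨fun hc => absurd hc (nd v hvp hvlt), fun _ => by omega, ?_,
      fun hc => absurd hc (nd v hvp hvlt), fun _ _ => by omega, fun _ => ?_⟩
    · intro x hx hxl
      rcases (hm x).1 hxl with h6 | h6 | h6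
      · exact Or.inl h6
      · exact absurd hx (by rw [h6]; exact nd a ha (by omega))
      · exact absurd hx (by rw [h6]; exact nd b hb (by omega))
    · rcases Nat.le_total a b with h6 | h6
      · rw [show v = b by omega, show h - b = a by omega]
        exact ⟨nb, na, fun x _ => by rw [hm]; tauto⟩
      · rw [show v = a by omega, show h - a = b by omega]
        exact ⟨na, nb, fun x _ => by rw [hm]⟩

theorem core_facts {n h : ℕ} (hh : h = 2 * n + 1) {lam : BPartition} (hc : IsBarCore h lam) :
    (∀ x, x ∈ partsM lam → ¬ h ∣ x) ∧ (∀ x, x ∈ partsM lam → h < x → x - h ∈ partsM lam) ∧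
    (∀ a b, a ∈ partsM lam → b ∈ partsM lam → a + b ≠ h) := by
  obtain ⟨hs, hno⟩ := hc
  have hs' := (hstrict_iff _ _).1 hs
  have pos : ∀ x, x ∈ partsM lam → 0 < x := fun x hx => (mem_partsM.1 hx).1
  have z0 : 0 ∉ partsM lam := fun h0 => by simpa using pos 0 h0
  have er : ∀ (a x : ℕ), ((partsM lam).erase a).count x ≤ (partsM lam).count x :=
    fun a x => Multiset.count_le_of_le _ (Multiset.erase_le _ _)
  have hh0 : ∀ x, x ∈ partsM lam → x = h → False := by
    intro x hx hxh
    obtain ⟨mu, hmu⟩ := exists_partsM ((partsM lam).erase x)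
      (fun h0 => z0 (Multiset.mem_of_mem_erase h0))
    refine hno mu ⟨x, (hstrict_iff _ _).2 ?_, Or.inl ⟨hxh, hx, hmu⟩⟩
    intro y hy
    rw [hmu]
    exact le_trans (er _ _) (hs' y hy)
  have hbig : ∀ x, x ∈ partsM lam → h < x → (h ∣ x ∨ x - h ∉ partsM lam) → False := by
    intro x hx hlt hor
    obtain ⟨mu, hmu⟩ := exists_partsM ((x - h) ::ₘ (partsM lam).erase x) (by
      rw [Multiset.mem_cons]
      rintro (h0 | h0)
      · omega
      · exact z0 (Multiset.mem_of_mem_erase h0))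
    refine hno mu ⟨x, (hstrict_iff _ _).2 ?_, Or.inr (Or.inl ⟨hlt, hx, hmu⟩)⟩
    intro y hy
    rw [hmu, Multiset.count_cons]
    split_ifs with h1
    · have : x - h ∉ partsM lam := by
        rcases hor with h2 | h2
        · exact absurd (h1 ▸ Nat.dvd_sub h2 (dvd_refl h)) hy
        · exact h2
      have := Multiset.count_eq_zero.2 this
      have := er x (x - h)
      rw [h1]; omega
    · exact le_trans (er _ _) (hs' y hy)
  refine ⟨?_, ?_, ?_⟩
  · intro x hx hd
    rcases lt_or_eq_of_le (Nat.le_of_dvd (pos x hx) hd) with h1 | h1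
    · exact hbig x hx h1 (Or.inl hd)
    · exact hh0 x hx h1.symm
  · intro x hx hlt
    by_contra hc
    exact hbig x hx hlt (Or.inr hc)
  · intro a b ha hb hab
    have hne : b ≠ a := by omega
    obtain ⟨mu, hmu⟩ := exists_partsM (((partsM lam).erase a).erase b)
      (fun h0 => z0 (Multiset.mem_of_mem_erase (Multiset.mem_of_mem_erase h0)))
    refine hno mu ⟨max a b, (hstrict_iff _ _).2 ?_, Or.inr (Or.inr ⟨a, b, hab, ha,
      (Multiset.mem_erase_of_ne hne).2 hb, rfl, hmu⟩)⟩
    intro y hy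
    rw [hmu]
    exact le_trans (Multiset.count_le_of_le _ (Multiset.erase_le _ _)) (le_trans (er _ _) (hs' y hy))

end BPartition

namespace BPartition

/-- doubled abacus predicate -/
def dbl (lam : BPartition) (z : ℤ) : Prop := z ∈ abacus lam

theorem dbl_pos (lam : BPartition) {x : ℕ} (hx : 0 < x) : dbl lam (x : ℤ) ↔ x ∈ partsM lam := by
  unfold dbl abacus
  simp only [Set.mem_ofPred_eq, Int.toNat_natCast]
  constructor
  · rintro (h1 | h1 | h1)
    · omega
    · exact h1.2
    · omega
  · intro h1; right; left; exact ⟨by omega, h1⟩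

theorem dbl_neg (lam : BPartition) {x : ℕ} (hx : 0 < x) :
    dbl lam (-(x : ℤ)) ↔ x ∉ partsM lam := by
  unfold dbl abacus
  simp only [Set.mem_ofPred_eq, neg_neg, Int.toNat_natCast]
  constructor
  · rintro (h1 | h1 | h1)
    · omega
    · omega
    · exact h1.2
  · intro h1; right; right; exact ⟨by omega, h1⟩

theorem dbl_pos' (lam : BPartition) {x : ℕ} {z : ℤ} (hx : 0 < x) (e : z = x) :
    dbl lam z ↔ x ∈ partsM lam := by rw [e]; exact dbl_pos lam hx

theorem dbl_neg' (lam : BPartition) {x : ℕ} {z : ℤ} (hx : 0 < x) (e : z = -(x : ℤ)) :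
    dbl lam z ↔ x ∉ partsM lam := by rw [e]; exact dbl_neg lam hx

theorem dbl_mir (lam : BPartition) {z : ℤ} (hz : z ≠ 0) : dbl lam (-z) ↔ ¬ dbl lam z := by
  rcases lt_or_gt_of_ne hz with h1 | h1
  · rw [dbl_neg' lam (x := z.natAbs) (z := z) (by omega) (by omega),
      dbl_pos' lam (x := z.natAbs) (z := -z) (by omega) (by omega)]
    tauto
  · rw [dbl_neg' lam (x := z.natAbs) (z := -z) (by omega) (by omega),
      dbl_pos' lam (x := z.natAbs) (z := z) (by omega) (by omega)]

theorem step_dbl {n h : ℕ} (hh : h = 2 * n + 1) {lam nu : BPartition} {v : ℕ}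
    (hs : IsHStrict h lam) (st : barStepRec h lam nu v) :
    (h ∣ v → ∀ z : ℤ, ¬ (h : ℤ) ∣ z → (dbl lam z ↔ dbl nu z)) ∧
    (¬ h ∣ v → dbl nu ((v : ℤ) - h) ∧ ¬ dbl nu v ∧ ∀ z : ℤ, ¬ (h : ℤ) ∣ z →
      (dbl lam z ↔ (dbl nu z ∧ z ≠ v - h ∧ z ≠ -v) ∨ z = v ∨ z = h - v)) := by
  obtain ⟨-, -, -, m1, m2, m3⟩ := step_mem hh hs st
  have hnv : n < v := (step_FF hh st (fun _ => 0) rfl).1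
  have sgn : ∀ z : ℤ, ¬ (h : ℤ) ∣ z → ∃ x : ℕ, 0 < x ∧ ¬ h ∣ x ∧ (z = x ∨ z = -(x : ℤ)) := by
    intro z hz
    have h0 : z ≠ 0 := fun h0 => hz (h0 ▸ dvd_zero _)
    refine ⟨z.natAbs, by omega, ?_, by omega⟩
    intro hc
    exact hz (Int.natCast_dvd.2 hc)
  refine ⟨?_, ?_⟩
  · intro hv z hz
    obtain ⟨x, hx0, hx, rfl | rfl⟩ := sgn z hz
    · rw [dbl_pos _ hx0, dbl_pos _ hx0]; exact m1 hv x hx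
    · rw [dbl_neg _ hx0, dbl_neg _ hx0, m1 hv x hx]
  · intro hv
    have hvh : v ≠ h := fun hc => hv (hc ▸ dvd_refl v)
    rcases Nat.lt_or_ge v h with hlt | hge
    · obtain ⟨a1, a2, a3⟩ := m3 hlt
      refine ⟨(dbl_neg' nu (x := h - v) (by omega) (by omega)).2 a2,
        (dbl_pos nu (by omega)).not.2 a1, ?_⟩
      intro z hz
      obtain ⟨x, hx0, hx, rfl | rfl⟩ := sgn z hz
      · rw [dbl_pos _ hx0, dbl_pos _ hx0, a3 x hx]
        have e1 : ((x : ℤ) = v) ↔ x = v := by omega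
        have e2 : ((x : ℤ) = h - v) ↔ x = h - v := by omega
        have e3 : (x : ℤ) ≠ v - h := by omega
        have e4 : (x : ℤ) ≠ - v := by omega
        grind
      · rw [dbl_neg _ hx0, dbl_neg _ hx0, a3 x hx]
        have e1 : ¬ (-(x : ℤ) = v) := by omega
        have e2 : ¬ (-(x : ℤ) = h - v) := by omega
        have e3 : (-(x : ℤ) = v - h) ↔ x = h - v := by omega
        have e4 : (-(x : ℤ) = -v) ↔ x = v := by omega
        grind
    · obtain ⟨a1, a2, a3⟩ := m2 hv (by omega)
      refine ⟨(dbl_pos' nu (x := v - h) (by omega) (by omega)).2 a1,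
        (dbl_pos nu (by omega)).not.2 a2, ?_⟩
      intro z hz
      obtain ⟨x, hx0, hx, rfl | rfl⟩ := sgn z hz
      · rw [dbl_pos _ hx0, dbl_pos _ hx0, a3 x hx]
        have e1 : ((x : ℤ) = v) ↔ x = v := by omega
        have e2 : ¬ ((x : ℤ) = h - v) := by omega
        have e3 : ((x : ℤ) = v - h) ↔ x = v - h := by omega
        have e4 : (x : ℤ) ≠ - v := by omega
        grind
      · rw [dbl_neg _ hx0, dbl_neg _ hx0, a3 x hx]
        have e1 : ¬ (-(x : ℤ) = v) := by omega
        have e2 : (-(x : ℤ) = h - v) ↔ x = v - h := by omega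
        have e3 : ¬ (-(x : ℤ) = v - h) := by omega
        have e4 : (-(x : ℤ) = -v) ↔ x = v := by omega
        grind

/-- core abacus -/
structure CoreX (h : ℤ) (X : ℤ → Prop) : Prop where
  cl : ∀ z, X z → X (z - h)
  mir : ∀ z, z ≠ 0 → (X (-z) ↔ ¬ X z)
  mul : ∀ z, h ∣ z → (X z ↔ z ≤ 0)

theorem coreX {n h : ℕ} (hh : h = 2 * n + 1) {lam : BPartition} (hc : IsBarCore h lam) :
    CoreX h (dbl lam) := by
  obtain ⟨f1, f2, f3⟩ := core_facts hh hc
  have hmul : ∀ z : ℤ, (h : ℤ) ∣ z → (dbl lam z ↔ z ≤ 0) := by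
    intro z hz
    rcases lt_trichotomy z 0 with h1 | h1 | h1
    · rw [dbl_neg' lam (x := z.natAbs) (by omega) (by omega)]
      constructor
      · intro; omega
      · intro _ h2; exact f1 _ h2 (Int.natCast_dvd.1 hz)
    · subst h1; simp [dbl, abacus]
    · rw [dbl_pos' lam (x := z.natAbs) (by omega) (by omega)]
      constructor
      · intro h2; exact absurd (Int.natCast_dvd.1 hz) (f1 _ h2)
      · intro; omega
  refine ⟨?_, fun z hz => dbl_mir lam hz, hmul⟩
  intro z hz
  by_cases hd : (h : ℤ) ∣ z
  · have := (hmul z hd).1 hz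
    exact (hmul _ (dvd_sub hd (dvd_refl _))).2 (by omega)
  · have h0 : z ≠ 0 := fun h0 => hd (h0 ▸ dvd_zero _)
    have hne : z ≠ h := fun h0 => hd (h0 ▸ dvd_refl _)
    rcases lt_or_gt_of_ne h0 with h1 | h1
    · rw [dbl_neg' lam (x := z.natAbs) (by omega) (by omega)] at hz
      rw [dbl_neg' lam (x := z.natAbs + h) (by omega) (by omega)]
      intro h2
      have := f2 _ h2 (by omega)
      rw [Nat.add_sub_cancel] at this
      exact hz this
    · rw [dbl_pos' lam (x := z.natAbs) (by omega) (by omega)] at hz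
      rcases lt_or_gt_of_ne hne with h2 | h2
      · rw [dbl_neg' lam (x := h - z.natAbs) (by omega) (by omega)]
        intro h3
        exact f3 _ _ hz h3 (by omega)
      · rw [dbl_pos' lam (x := z.natAbs - h) (by omega) (by omega)]
        exact f2 _ hz (by omega)

/-- the shape of a weight 2 partition over the core -/
def Ty (h n : ℤ) (X Y : ℤ → Prop) (c v : ℤ) : Prop :=
  n < c ∧ n < v ∧ X (c - h) ∧ ¬ X c ∧
  ((c ≠ v ∧ X (v - h) ∧ ¬ X v ∧ ∀ z, ¬ h ∣ z → (Y z ↔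
      (X z ∧ z ≠ c - h ∧ z ≠ -c ∧ z ≠ v - h ∧ z ≠ -v) ∨ z = c ∨ z = h - c ∨ z = v ∨ z = h - v)) ∨
   (v = c + h ∧ ∀ z, ¬ h ∣ z → (Y z ↔ (X z ∧ z ≠ c - h ∧ z ≠ -c - h) ∨ z = c + h ∨ z = h - c)) ∨
   ((v = c - h ∨ v = 2 * h - c) ∧
     ∀ z, ¬ h ∣ z → (Y z ↔ (X z ∧ z ≠ -c ∧ z ≠ c - 2 * h) ∨ z = c ∨ z = 2 * h - c)))

theorem Ty_of_steps {n h : ℕ} (hh : h = 2 * n + 1) {lam nu σ : BPartition} {v c : ℕ}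
    (hσ : IsBarCore h σ) (hs : IsHStrict h lam)
    (st1 : barStepRec h lam nu v) (st2 : barStepRec h nu σ c) :
    Ty h n (dbl σ) (dbl lam) c v := by
  have CX := coreX hh hσ
  have s1 := step_dbl hh hs st1
  have s2 := step_dbl hh st1.1 st2
  have m1 := step_mem hh hs st1
  have m2 := step_mem hh st1.1 st2
  have hnv : n < v := (step_FF hh st1 (fun _ => 0) rfl).1
  have hnc : n < c := (step_FF hh st2 (fun _ => 0) rfl).1
  have f1 := (core_facts hh hσ).1
  have hhd : (h : ℤ) ∣ h := dvd_refl _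
  have hcm : h ∣ c → c = h := by
    intro hc
    rcases m2.1 hc with h1 | h1
    · exact h1
    · exact absurd (Nat.dvd_sub hc (dvd_refl h)) (f1 _ h1)
  have hvm : h ∣ v → v = h ∨ (v = h + h ∧ c = h) := by
    intro hv
    rcases m1.1 hv with h1 | h1
    · exact Or.inl h1
    · right
      have hd := Nat.dvd_sub hv (dvd_refl h)
      rcases m2.2.2.1 _ hd h1 with h2 | h2
      · exact absurd hd (f1 _ h2)
      · have h3 : c = h := hcm (h2 ▸ hd)
        exact ⟨by omega, h3⟩
  have Xh : ¬ dbl σ (h : ℤ) := fun h1 => by have := (CX.mul _ hhd).1 h1; omega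
  have X0 : dbl σ ((h : ℤ) - h) := (CX.mul _ (by simp)).2 (by omega)
  by_cases hc : h ∣ c
  · have hc' := hcm hc
    subst hc'
    have e2 := s2.1 hc
    by_cases hv : c ∣ v
    · have e1 := s1.1 hv
      have hY : ∀ z : ℤ, ¬ (c : ℤ) ∣ z → (dbl lam z ↔ dbl σ z) := fun z hz =>
        (e1 z hz).trans (e2 z hz)
      refine ⟨by omega, by omega, X0, Xh, Or.inr ?_⟩
      rcases hvm hv with h1 | h1
      · right
        refine ⟨by omega, fun z hz => ?_⟩
        have z0 : z ≠ c := fun h0 => hz (h0 ▸ hhd)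
        have z1 : z ≠ -c := fun h0 => hz (h0 ▸ (by simp))
        rw [hY z hz]
        constructor
        · intro h2; left; exact ⟨h2, z1, by omega⟩
        · rintro (h2 | h2 | h2)
          · exact h2.1
          · omega
          · omega
      · left
        refine ⟨by omega, fun z hz => ?_⟩
        have z0 : z ≠ 0 := fun h0 => hz (h0 ▸ dvd_zero _)
        have z1 : z ≠ -c - c := fun h0 => hz (h0 ▸ ⟨-2, by ring⟩)
        have z2 : z ≠ c + c := fun h0 => hz (h0 ▸ ⟨2, by ring⟩)
        rw [hY z hz]
        constructor
        · intro h2; left; exact ⟨h2, by omega, z1⟩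
        · rintro (h2 | h2 | h2)
          · exact h2.1
          · omega
          · omega
    · obtain ⟨b1, b2, b3⟩ := s1.2 hv
      have hvz : ¬ (c : ℤ) ∣ (v : ℤ) := fun hd => hv (by exact_mod_cast hd)
      have hvz' : ¬ (c : ℤ) ∣ (v : ℤ) - c := fun hd => hvz (by
        have := dvd_add hd hhd; rwa [sub_add_cancel] at this)
      rw [e2 _ hvz'] at b1
      rw [e2 _ hvz] at b2
      refine ⟨by omega, by omega, X0, Xh, Or.inl ⟨?_, b1, b2, fun z hz => ?_⟩⟩
      · intro h1; exact hvz (h1 ▸ hhd)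
      · have z0 : z ≠ 0 := fun h0 => hz (h0 ▸ dvd_zero _)
        have z1 : z ≠ -c := fun h0 => hz (h0 ▸ (by simp))
        have z2 : z ≠ c := fun h0 => hz (h0 ▸ hhd)
        rw [b3 z hz, e2 z hz]
        constructor
        · rintro (h2 | h2 | h2)
          · left; exact ⟨h2.1, by omega, z1, h2.2⟩
          · right; right; right; left; exact h2
          · right; right; right; right; exact h2
        · rintro (h2 | h2 | h2 | h2 | h2)
          · left; exact ⟨h2.1, h2.2.2.2⟩
          · omega
          · omega
          · right; left; exact h2
          · right; right; exact h2
  · obtain ⟨d1, d2, d3⟩ := s2.2 hc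
    have hcz : ¬ (h : ℤ) ∣ (c : ℤ) := fun hd => hc (by exact_mod_cast hd)
    refine ⟨by omega, by omega, d1, d2, ?_⟩
    have hch : c ≠ h := fun h1 => hc (h1 ▸ dvd_refl _)
    by_cases hv : h ∣ v
    · have hv' : v = h := by
        rcases hvm hv with h1 | h1
        · exact h1
        · exact absurd h1.2 hch
      have e1 := s1.1 hv
      subst hv'
      refine Or.inl ⟨by omega, X0, Xh, fun z hz => ?_⟩
      have z0 : z ≠ 0 := fun h0 => hz (h0 ▸ dvd_zero _)
      have z1 : z ≠ -v := fun h0 => hz (h0 ▸ (by simp))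
      have z2 : z ≠ v := fun h0 => hz (h0 ▸ hhd)
      rw [e1 z hz, d3 z hz]
      constructor
      · rintro (h2 | h2 | h2)
        · left; exact ⟨h2.1, h2.2.1, h2.2.2, by omega, z1⟩
        · right; left; exact h2
        · right; right; left; exact h2
      · rintro (h2 | h2 | h2 | h2 | h2)
        · left; exact ⟨h2.1, h2.2.1, h2.2.2.1⟩
        · right; left; exact h2
        · right; right; exact h2
        · omega
        · omega
    · obtain ⟨b1, b2, b3⟩ := s1.2 hv
      have hvz : ¬ (h : ℤ) ∣ (v : ℤ) := fun hd => hv (by exact_mod_cast hd)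
      have hvz' : ¬ (h : ℤ) ∣ (v : ℤ) - h := fun hd => hvz (by
        have := dvd_add hd hhd; rwa [sub_add_cancel] at this)
      rw [d3 _ hvz'] at b1
      rw [d3 _ hvz] at b2
      push Not at b2
      obtain ⟨b2, b4, b5⟩ := b2
      have hvh : v ≠ h := fun h1 => hv (h1 ▸ dvd_refl _)
      have hB : ∀ z : ℤ, ¬ (h : ℤ) ∣ z → (dbl lam z ↔
          (((dbl σ z ∧ z ≠ c - h ∧ z ≠ -c) ∨ z = c ∨ z = h - c) ∧ z ≠ v - h ∧ z ≠ -v) ∨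
          z = v ∨ z = h - v) := fun z hz => by rw [b3 z hz, d3 z hz]
      clear b3 d3
      rcases b1 with b1 | b1 | b1
      · by_cases hXv : dbl σ (v : ℤ)
        · -- type C
          have : (v : ℤ) = c - h := by
            by_contra h1
            have := b2 hXv h1
            omega
          refine Or.inr (Or.inr ⟨Or.inl this, fun z hz => ?_⟩)
          have hv2 : (c : ℤ) = v + h := by omega
          rw [hB z hz]
          rw [hv2]
          by_cases x1 : z = (v : ℤ)
          · subst x1; grind
          · have hm := (CX.mir (v : ℤ) (by omega)).not.2 (by simpa using hXv)
            by_cases x3 : z = -(v : ℤ)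
            · subst x3; simp only [hm]; grind
            · clear hB s1 s2 m1 m2 b2 st1 st2 CX f1 hcm hvm
              grind
        · refine Or.inl ⟨by omega, b1.1, hXv, fun z hz => ?_⟩
          have n1 : (v : ℤ) ≠ c - h := fun h1 => hXv (h1 ▸ d1)
          have n2 : (v : ℤ) - h ≠ c := fun h1 => d2 (h1 ▸ b1.1)
          have n3 : (v : ℤ) - h ≠ -((c : ℤ) - h) := fun h1 =>
            (CX.mir ((c : ℤ) - h) (by omega)).1 (h1 ▸ b1.1) d1
          rw [hB z hz]
          clear hB s1 s2 m1 m2 b2 st1 st2 CX f1 hcm hvm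
          grind
      · refine Or.inr (Or.inl ⟨by omega, fun z hz => ?_⟩)
        rw [hB z hz]
        have hv2 : (v : ℤ) = c + h := by omega
        rw [hv2]
        by_cases x1 : z = -(c : ℤ)
        · have := (CX.mir (c : ℤ) (by omega)).2 d2
          subst x1; grind
        · by_cases x2 : z = (c : ℤ)
          · subst x2; grind
          · grind
      · refine Or.inr (Or.inr ⟨Or.inr (by omega), fun z hz => ?_⟩)
        rw [hB z hz]
        have hv2 : (v : ℤ) = 2 * h - c := by omega
        rw [hv2]
        by_cases x1 : z = h - (c : ℤ)
        · have := (CX.mir ((c : ℤ) - h) (by omega)).not.2 (by simpa using d1)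
          rw [neg_sub] at this
          subst x1; grind
        · by_cases x2 : z = (c : ℤ) - h
          · subst x2; grind
          · grind

end BPartition

namespace BPartition

/-- dominance in terms of positions -/
def DomZ (h u v u' v' : ℤ) : Prop :=
  (min u v ≤ min u' v' ∧ max u v ≤ max u' v') ∨
    (min u' v' < min u v ∧ u + v ≤ 2 * h ∧ u + v ≤ u' + v')

theorem DomZ_iff (h u v u' v' : ℤ) : DomZ h u v u' v' ↔
    ((u ≤ u' ∧ v ≤ v') ∨ (u ≤ v' ∧ v ≤ u')) ∨
    (((u' < u ∧ u' < v) ∨ (v' < u ∧ v' < v)) ∧ u + v ≤ 2 * h ∧ u + v ≤ u' + v') := by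
  unfold DomZ
  rcases le_total u v with h1 | h1 <;> rcases le_total u' v' with h2 | h2 <;>
    simp only [min_eq_left, min_eq_right, max_eq_left, max_eq_right, h1, h2] <;> omega

open Classical in
/-- action on positions for i ≥ 1 -/
noncomputable def stt (L : ℤ → Prop) (n p : ℤ) : ℤ :=
  if L p then p + 1 else if L (p - 1) ∧ p ≠ n + 1 then p - 1 else p

theorem stt_cases (L : ℤ → Prop) (n p : ℤ) : (stt L n p = p + 1 ∧ L p) ∨
    (stt L n p = p - 1 ∧ L (p - 1) ∧ p ≠ n + 1 ∧ ¬ L p) ∨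
    (stt L n p = p ∧ ¬ L p ∧ (L (p - 1) → p = n + 1)) := by
  unfold stt
  split_ifs with h1 h2
  · exact Or.inl ⟨rfl, h1⟩
  · exact Or.inr (Or.inl ⟨rfl, h2.1, h2.2, h1⟩)
  · exact Or.inr (Or.inr ⟨rfl, h1, fun h3 => by by_contra h4; exact h2 ⟨h3, h4⟩⟩)

theorem stt_mono {h : ℕ} {L : ℤ → Prop} (LP : LProp h L) {n a b : ℤ} (ha : n < a)
    (hc : ¬ (L a ∧ b = a + 1)) (hab : a < b) : stt L n a < stt L n b := by
  have s1 : L a → L (b - 1) → b ≠ a + 2 := by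
    intro h1 h2 h3
    apply LP.succ _ h1
    rwa [show a + 1 = b - 1 by omega]
  have s2 : ¬ L a → L (b - 1) → b ≠ a + 1 := by
    intro h1 h2 h3
    apply h1
    rwa [show a = b - 1 by omega]
  rcases stt_cases L n a with ⟨e1, f1⟩ | ⟨e1, f1, f2, f3⟩ | ⟨e1, f1, f2⟩ <;>
  rcases stt_cases L n b with ⟨e2, g1⟩ | ⟨e2, g1, g2, g3⟩ | ⟨e2, g1, g2⟩
  · omega
  · have := s1 f1 g1
    have : b ≠ a + 1 := fun h => hc ⟨f1, h⟩
    omega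
  · have : b ≠ a + 1 := fun h => hc ⟨f1, h⟩
    omega
  · omega
  · omega
  · omega
  · omega
  · have := s2 f1 g1
    omega
  · omega

section
variable {n h : ℕ} {L X Y Y' : ℤ → Prop} {c v c' v' : ℤ}

theorem LP_ref (LP : LProp h L) {a b : ℤ} (ha : L a) (hab : a + b = 2 * h - 1) : L b := by
  have := LP.add _ (LP.add _ (LP.mir _ ha))
  rwa [show b = -1 - a + h + h by omega]

theorem E1 (hh : h = 2 * n + 1) (LP : LProp h L) (CX : CoreX h X)
    (K : ∀ z, L z → X (z + 1) → X (z + h)) (T : Ty h n X Y c v)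
    (hc : L (c - 1)) (hv : L (v - 1)) (hs : c + v = 2 * h + 1) : False := by
  obtain ⟨t1, t2, t3, t4, ⟨a1, a2, a3, a4⟩ | ⟨b1, b2⟩ | ⟨b1, b2⟩⟩ := T
  · have k1 := K (c - h - 1) (by rw [show c - h - 1 = c - 1 - h by ring]; exact LP.sub _ hc)
      (by rw [show c - h - 1 + 1 = c - h by ring]; exact t3)
    rw [show c - h - 1 + h = c - 1 by ring] at k1
    have k2 := CX.cl _ a2
    rw [show v - h - h = -(c - 1) by omega] at k2
    have h0 : c - 1 ≠ 0 := fun h0 => LP.nd _ hc (h0 ▸ dvd_zero _)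
    exact (CX.mir _ h0).1 k2 k1
  · have hcn : c = n + 1 := by omega
    subst hcn
    have k1 := K (-n - 1) (by
      have := LP.mir _ hc
      rwa [show (-1 - ((n : ℤ) + 1 - 1)) = -n - 1 by ring] at this)
      (by rwa [show -(n : ℤ) - 1 + 1 = n + 1 - h by omega])
    rw [show -(n : ℤ) - 1 + h = n by omega] at k1
    rw [show (n : ℤ) + 1 - h = -n by omega] at t3
    refine (CX.mir _ ?_).1 t3 k1
    intro h0
    exact LP.nd _ hc (by rw [h0]; simp)
  · rcases b1 with b1 | b1
    · have hvn : v = n + 1 := by omega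
      have hcn : c = h + n + 1 := by omega
      subst hvn hcn
      have k1 := K n (by rwa [show (n : ℤ) + 1 - 1 = n by ring] at hv)
        (by rwa [show (h : ℤ) + n + 1 - h = n + 1 by ring] at t3)
      have k2 := CX.cl _ k1
      have k3 := CX.cl _ t3
      rw [show (n : ℤ) + h - h = n by ring] at k2
      rw [show (h : ℤ) + n + 1 - h - h = -n by omega] at k3
      refine (CX.mir _ ?_).1 k3 k2
      intro h0
      exact LP.nd _ hv (by rw [h0]; simp)
    · omega

theorem E2 (hh : h = 2 * n + 1) (LP : LProp h L)
    (T : Ty h n X Y c v) (U : ∀ z, L z → Y (z + 1) → Y z)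
    (hc : L c) (hv : L v) (hs : c + v = 2 * h - 1) : False := by
  obtain ⟨t1, t2, t3, t4, ⟨a1, a2, a3, a4⟩ | ⟨b1, b2⟩ | ⟨b1, b2⟩⟩ := T
  · have hL := LP.sub _ hc
    have y1 := U _ hL ((a4 _ (LP.nd' _ hL)).2 (by right; right; right; right; omega))
    have hch : c ≠ h := fun h0 => LP.nd _ hc (h0 ▸ dvd_refl _)
    rcases (a4 _ (LP.nd _ hL)).1 y1 with h1 | h1 | h1 | h1 | h1
    · exact h1.2.1 rfl
    · omega
    · omega
    · exact a3 (h1 ▸ t3)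
    · omega
  · omega
  · omega

theorem clash (hh : h = 2 * n + 1) (LP : LProp h L) (CX : CoreX h X)
    (K : ∀ z, L z → X (z + 1) → X (z + h))
    (T : Ty h n X Y c v) (U : ∀ z, L z → Y (z + 1) → Y z)
    (T' : Ty h n X Y' c' v') (U' : ∀ z, L z → Y' (z + 1) → Y' z)
    {p : ℤ} (hp : L p) (h1 : p = c ∨ p = v) (h2 : p + 1 = c' ∨ p + 1 = v') :
    v = p ∧ c = p + h ∧ p + 1 = v' ∧ (c' = p + 1 - h ∨ c' = 2 * h - p - 1) := by
  have hp0 : p ≠ h := fun h0 => LP.nd _ hp (h0 ▸ dvd_refl _)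
  have hp1 : p + 1 ≠ h := fun h0 => LP.nd' _ hp (h0 ▸ dvd_refl _)
  have fr : X (p + 1 - h) → X p := by
    intro h3
    have := K (p - h) (LP.sub _ hp) (by rwa [show p - h + 1 = p + 1 - h by ring])
    rwa [show p - h + h = p by ring] at this
  have two : X p → v = p ∧ c = p + h ∧ ¬ X (p + h) ∧ ¬ X (p + 1 - h) := by
    intro hX
    obtain ⟨t1, t2, t3, t4, ⟨a1, a2, a3, a4⟩ | ⟨b1, b2⟩ | ⟨b1, b2⟩⟩ := T
    · rcases h1 with rfl | rfl
      · exact absurd hX t4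
      · exact absurd hX a3
    · rcases h1 with rfl | rfl
      · exact absurd hX t4
      · have := CX.cl _ hX
        rw [b1, show c + h - h = c by ring] at this
        exact absurd this t4
    · rcases h1 with rfl | rfl
      · exact absurd hX t4
      · rcases b1 with b1 | b1
        · have hc : c = p + h := by omega
          subst hc
          refine ⟨rfl, rfl, t4, fun h3 => ?_⟩
          have hL := LP.sub _ hp
          have y1 := U _ hL ((b2 _ (LP.nd' _ hL)).2 (by
            left
            refine ⟨by rwa [show p - h + 1 = p + 1 - h by ring], by omega, by omega⟩))
          rcases (b2 _ (LP.nd _ hL)).1 y1 with h4 | h4 | h4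
          · exact absurd (by ring) h4.2.2
          · omega
          · omega
        · exfalso
          have k := CX.cl _ hX
          rw [show p - h = -(c - h) by omega] at k
          exact (CX.mir _ (by omega)).1 k t3
  obtain ⟨t1, t2, t3, t4, ⟨a1, a2, a3, a4⟩ | ⟨b1, b2⟩ | ⟨b1, b2⟩⟩ := T'
  · exfalso
    rcases h2 with rfl | rfl
    · exact (two (fr t3)).2.2.2 t3
    · exact (two (fr a2)).2.2.2 a2
  · rcases h2 with rfl | rfl
    · exfalso; exact (two (fr t3)).2.2.2 t3
    · have y1 := U' _ hp ((b2 _ (LP.nd' _ hp)).2 (by right; left; exact b1))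
      have hX : X p := by
        rcases (b2 _ (LP.nd _ hp)).1 y1 with h4 | h4 | h4
        · exact h4.1
        · omega
        · omega
      exact ⟨(two hX).1, (two hX).2.1, rfl, by omega⟩
  · rcases h2 with rfl | rfl
    · exfalso; exact (two (fr t3)).2.2.2 t3
    · rcases b1 with b1 | b1
      · exfalso
        have hc : c' = p + 1 + h := by omega
        subst hc
        rw [show p + 1 + h - h = p + 1 by ring] at t3
        have k := K _ hp t3
        have hX := CX.cl _ k
        rw [show p + h - h = p by ring] at hX
        exact (two hX).2.2.1 k
      · have y1 := U' _ hp ((b2 _ (LP.nd' _ hp)).2 (by right; right; exact b1))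
        have hX : X p := by
          rcases (b2 _ (LP.nd _ hp)).1 y1 with h4 | h4 | h4
          · exact h4.1
          · omega
          · omega
        exact ⟨(two hX).1, (two hX).2.1, rfl, by omega⟩

theorem stt_left {n p : ℤ} (hL : L p) : stt L n p = p + 1 := by
  unfold stt; rw [if_pos hL]

theorem stt_right (LP : LProp h L) {n p : ℤ} (hL : L (p - 1)) (hp : p ≠ n + 1) :
    stt L n p = p - 1 := by
  unfold stt
  rw [if_neg, if_pos ⟨hL, hp⟩]
  intro h1
  apply LP.succ _ hL
  rwa [sub_add_cancel]

/-- both order relations in the clash situation -/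
theorem clash_dom (hh : h = 2 * n + 1) (LP : LProp h L) {p : ℤ} (hp : L p) (hnp : n < p)
    (hc' : n < c') (e1 : v = p) (e2 : c = p + h) (e3 : p + 1 = v')
    (e4 : c' = p + 1 - h ∨ c' = 2 * h - p - 1) :
    ¬ DomZ h c v c' v' ∧ ¬ DomZ h (stt L n c) (stt L n v) (stt L n c') (stt L n v') ∧
    DomZ h c' v' c v ∧ DomZ h (stt L n c') (stt L n v') (stt L n c) (stt L n v) := by
  subst e1 e2 e3
  have s1 : stt L n v = v + 1 := stt_left hp
  have s2 : stt L n (v + h) = v + h + 1 := stt_left (LP.add _ hp)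
  have s3 : stt L n (v + 1) = v + 1 - 1 :=
    stt_right LP (by rwa [add_sub_cancel_right]) (by omega)
  have s4 : (c' = v + 1 - h ∧ stt L n c' ≤ c') ∨
      (c' = 2 * h - v - 1 ∧ stt L n c' = c' + 1) := by
    rcases e4 with e4 | e4
    · left
      refine ⟨e4, ?_⟩
      by_cases hn : c' = n + 1
      · have : ¬ L c' := by
          intro h1
          apply LP.succ _ (LP.sub _ hp)
          rwa [show v - h + 1 = c' by omega]
        rcases stt_cases L n c' with h1 | h1 | h1
        · exact absurd h1.2 this
        · omega
        · omega
      · have := stt_right (n := n) (p := c') LP (by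
          rw [show c' - 1 = v - h by omega]; exact LP.sub _ hp) hn
        omega
    · right
      exact ⟨e4, stt_left (LP_ref LP hp (by omega))⟩
  rw [s1, s2, s3]
  clear s1 s2 s3 e4
  generalize stt L n c' = a at *
  have hhz : (h : ℤ) = 2 * n + 1 := by omega
  have hn0 : n ≠ 0 := by
    intro h0
    apply LP.nd _ hp
    rw [show (h : ℤ) = 1 by omega]
    exact one_dvd _
  rcases s4 with ⟨e, f⟩ | ⟨e, f⟩
  · refine ⟨?_, ?_, ?_, ?_⟩ <;> rw [DomZ_iff] <;> omega
  · refine ⟨?_, ?_, ?_, ?_⟩ <;> rw [DomZ_iff] <;> omega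

theorem sums_aux (c v c1 v1 h n : ℤ) (A B C D : Prop)
    (r1 : A → c + v = 2 * h - 1 → B) (r2 : B → c + v = 2 * h - 1 → A)
    (r3 : A → B → c + v ≠ 2 * h - 1) (r4 : A → B → c + v ≠ 2 * h - 2)
    (r5 : A → c + v = 2 * h → D) (r6 : B → c + v = 2 * h → C)
    (r7 : C → c + v = 2 * h → B) (r8 : D → c + v = 2 * h → A)
    (r9 : C → D → c + v ≠ 2 * h + 1) (r10 : C → c + v = 2 * h + 1 → D)
    (r11 : D → c + v = 2 * h + 1 → C) (r12 : C → D → c + v ≠ 2 * h + 2)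
    (r13 : A → ¬ C) (r14 : B → ¬ D)
    (sc : (c1 = c + 1 ∧ A) ∨ (c1 = c - 1 ∧ C ∧ c ≠ n + 1 ∧ ¬ A) ∨
      (c1 = c ∧ ¬ A ∧ (C → c = n + 1)))
    (sv : (v1 = v + 1 ∧ B) ∨ (v1 = v - 1 ∧ D ∧ v ≠ n + 1 ∧ ¬ B) ∨
      (v1 = v ∧ ¬ B ∧ (D → v = n + 1))) :
    (c + v < 2 * h → c1 + v1 < 2 * h) ∧
    (2 * h ≤ c + v → 2 * h ≤ c1 + v1) ∧
    (2 * h < c + v → 2 * h < c1 + v1) ∧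
    (c ≠ n + 1 → v ≠ n + 1 → c + v = 2 * h → c1 + v1 = 2 * h) := by
  refine ⟨?_, ?_, ?_, ?_⟩ <;> intros <;> grind

theorem sums (hh : h = 2 * n + 1) (LP : LProp h L) (CX : CoreX h X)
    (K : ∀ z, L z → X (z + 1) → X (z + h))
    (T : Ty h n X Y c v) (U : ∀ z, L z → Y (z + 1) → Y z) :
      (c + v < 2 * h → stt L n c + stt L n v < 2 * h) ∧
      (2 * h ≤ c + v → 2 * h ≤ stt L n c + stt L n v) ∧
      (2 * h < c + v → 2 * h < stt L n c + stt L n v) ∧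
      (c ≠ n + 1 → v ≠ n + 1 → c + v = 2 * h → stt L n c + stt L n v = 2 * h) := by
  have r1 : L c → c + v = 2 * h - 1 → L v := fun h1 h2 => LP_ref LP h1 h2
  have r2 : L v → c + v = 2 * h - 1 → L c := fun h1 h2 => LP_ref LP h1 (by omega)
  have r3 : L c → L v → c + v ≠ 2 * h - 1 := fun h1 h2 h3 => E2 hh LP T U h1 h2 h3
  have r4 : L c → L v → c + v ≠ 2 * h - 2 := fun h1 h2 h3 =>
    LP.succ _ h2 (LP_ref LP h1 (by omega))
  have r5 : L c → c + v = 2 * h → L (v - 1) := fun h1 h2 => LP_ref LP h1 (by omega)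
  have r6 : L v → c + v = 2 * h → L (c - 1) := fun h1 h2 => LP_ref LP h1 (by omega)
  have r7 : L (c - 1) → c + v = 2 * h → L v := fun h1 h2 => LP_ref LP h1 (by omega)
  have r8 : L (v - 1) → c + v = 2 * h → L c := fun h1 h2 => LP_ref LP h1 (by omega)
  have r9 : L (c - 1) → L (v - 1) → c + v ≠ 2 * h + 1 := fun h1 h2 h3 =>
    E1 hh LP CX K T h1 h2 h3
  have r10 : L (c - 1) → c + v = 2 * h + 1 → L (v - 1) := fun h1 h2 => LP_ref LP h1 (by omega)
  have r11 : L (v - 1) → c + v = 2 * h + 1 → L (c - 1) := fun h1 h2 => LP_ref LP h1 (by omega)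
  have r12 : L (c - 1) → L (v - 1) → c + v ≠ 2 * h + 2 := by
    intro h1 h2 h3
    have h4 : L (v - 2) := LP_ref LP h1 (by omega)
    apply LP.succ _ h4
    rwa [show v - 2 + 1 = v - 1 by ring]
  have r13 : L c → ¬ L (c - 1) := fun h1 h2 => LP.succ _ h2 (by rwa [sub_add_cancel])
  have r14 : L v → ¬ L (v - 1) := fun h1 h2 => LP.succ _ h2 (by rwa [sub_add_cancel])
  have sc := stt_cases L n c
  have sv := stt_cases L n v
  exact sums_aux c v _ _ h n _ _ _ _ r1 r2 r3 r4 r5 r6 r7 r8 r9 r10 r11 r12 r13 r14 sc sv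

theorem tri {c c' a a' : ℤ}
    (q : (c < c' ∧ a < a') ∨ (c = c' ∧ a = a') ∨ (c' < c ∧ a' < a)) :
    (c ≤ c' ↔ a ≤ a') ∧ (c' < c ↔ a' < a) ∧ (c < c' ↔ a < a') := by omega

theorem maxlt {c v c' v' : ℤ} (hM : (c' < c ∧ c' < v) ∨ (v' < c ∧ v' < v))
    (hs : c + v ≤ c' + v') : (c < c' ∧ v < c' ∨ c < v' ∧ v < v') := by omega

theorem final_aux (c v c' v' a b a' b' h n : ℤ)
    (n1 : n < c) (n2 : n < v) (n3 : n < c') (n4 : n < v')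
    (q1 : (c < c' ∧ a < a') ∨ (c = c' ∧ a = a') ∨ (c' < c ∧ a' < a))
    (q2 : (c < v' ∧ a < b') ∨ (c = v' ∧ a = b') ∨ (v' < c ∧ b' < a))
    (q3 : (v < c' ∧ b < a') ∨ (v = c' ∧ b = a') ∨ (c' < v ∧ a' < b))
    (q4 : (v < v' ∧ b < b') ∨ (v = v' ∧ b = b') ∨ (v' < v ∧ b' < b))
    (S1 : c + v < 2 * h → a + b < 2 * h) (S2 : 2 * h ≤ c + v → 2 * h ≤ a + b)
    (S3 : 2 * h < c + v → 2 * h < a + b)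
    (S4 : c ≠ n + 1 → v ≠ n + 1 → c + v = 2 * h → a + b = 2 * h)
    (S1' : c' + v' < 2 * h → a' + b' < 2 * h) (S2' : 2 * h ≤ c' + v' → 2 * h ≤ a' + b')
    (Z : min c' v' < min c v → max c v < max c' v' → c + v < 2 * h → c' + v' < 2 * h → False) :
    DomZ h c v c' v' ↔ DomZ h a b a' b' := by
  rw [DomZ_iff, DomZ_iff]
  have I : ((c ≤ c' ∧ v ≤ v') ∨ (c ≤ v' ∧ v ≤ c')) ↔
      ((a ≤ a' ∧ b ≤ b') ∨ (a ≤ b' ∧ b ≤ a')) := by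
    rw [(tri q1).1, (tri q2).1, (tri q3).1, (tri q4).1]
  have M : ((c' < c ∧ c' < v) ∨ (v' < c ∧ v' < v)) ↔
      ((a' < a ∧ a' < b) ∨ (b' < a ∧ b' < b)) := by
    rw [(tri q1).2.1, (tri q2).2.1, (tri q3).2.1, (tri q4).2.1]
  have M' : (c < c' ∧ v < c' ∨ c < v' ∧ v < v') ↔ (a < a' ∧ b < a' ∨ a < b' ∧ b < b') := by
    rw [(tri q1).2.2, (tri q2).2.2, (tri q3).2.2, (tri q4).2.2]
  clear q1 q2 q3 q4
  rw [I, ← M]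
  by_cases hI : ((a ≤ a' ∧ b ≤ b') ∨ (a ≤ b' ∧ b ≤ a'))
  · simp only [hI, true_or]
  by_cases hM : ((c' < c ∧ c' < v) ∨ (v' < c ∧ v' < v))
  swap
  · simp only [hM, false_and]
  have Z1 : (c < c' ∧ v < c' ∨ c < v' ∧ v < v') → c + v < 2 * h → c' + v' < 2 * h → False := by
    intro hm
    refine Z ?_ ?_
    · rcases hM with ⟨a1, a2⟩ | ⟨a1, a2⟩
      · exact (min_le_left _ _).trans_lt (lt_min a1 a2)
      · exact (min_le_right _ _).trans_lt (lt_min a1 a2)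
    · rcases hm with ⟨a1, a2⟩ | ⟨a1, a2⟩
      · exact (max_lt a1 a2).trans_le (le_max_left _ _)
      · exact (max_lt a1 a2).trans_le (le_max_right _ _)
  have hM2 := M.1 hM
  have hI2 := mt I.1 hI
  clear I
  clear Z M
  simp only [hI, hM, false_or, true_and]
  constructor
  · rintro ⟨h2, h3⟩
    have h4 : 2 * h ≤ c' + v' := by
      by_contra h5
      exact Z1 (maxlt hM h3) (by clear hM hI2 hI M' Z1; omega) (by clear hM hI2 hI M' Z1; omega)
    have := S2' h4
    clear hI2 hI M' Z1 hM2
    have hx : c ≠ n + 1 ∧ v ≠ n + 1 := by omega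
    have := S4 hx.1 hx.2
    clear hM
    omega
  · rintro ⟨h2, h3⟩
    have h4 := M'.2 (maxlt hM2 h3)
    clear M' hI hI2 hM2
    have h5 : c + v ≤ 2 * h := by
      by_contra h5
      have := S3 (by omega)
      omega
    refine ⟨h5, ?_⟩
    by_contra h6
    rcases lt_or_eq_of_le h5 with h7 | h7
    · exact Z1 h4 h7 (by omega)
    · have := S4 (by omega) (by omega) h7
      have := S1' (by omega)
      omega

theorem main_pos (hh : h = 2 * n + 1) (LP : LProp h L) (CX : CoreX h X)
    (K : ∀ z, L z → X (z + 1) → X (z + h))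
    (T : Ty h n X Y c v) (U : ∀ z, L z → Y (z + 1) → Y z)
    (T' : Ty h n X Y' c' v') (U' : ∀ z, L z → Y' (z + 1) → Y' z)
    (Z : min c' v' < min c v → max c v < max c' v' → c + v < 2 * h → c' + v' < 2 * h → False) :
    DomZ h c v c' v' ↔ DomZ h (stt L n c) (stt L n v) (stt L n c') (stt L n v') := by
  have n1 : n < c := T.1
  have n2 : n < v := T.2.1
  have n3 : n < c' := T'.1
  have n4 : n < v' := T'.2.1
  by_cases hc1 : ∃ p, L p ∧ (p = c ∨ p = v) ∧ (p + 1 = c' ∨ p + 1 = v')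
  · obtain ⟨p, hp, h1, h2⟩ := hc1
    obtain ⟨e1, e2, e3, e4⟩ := clash hh LP CX K T U T' U' hp h1 h2
    have := clash_dom hh LP hp (by omega) n3 e1 e2 e3 e4
    exact iff_of_false this.1 this.2.1
  by_cases hc2 : ∃ p, L p ∧ (p = c' ∨ p = v') ∧ (p + 1 = c ∨ p + 1 = v)
  · obtain ⟨p, hp, h1, h2⟩ := hc2
    obtain ⟨e1, e2, e3, e4⟩ := clash hh LP CX K T' U' T U hp h1 h2
    have := clash_dom hh LP hp (by omega) n1 e1 e2 e3 e4
    exact iff_of_true this.2.2.1 this.2.2.2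
  push Not at hc1 hc2
  have o1 : ∀ a b, (a = c ∨ a = v) → (b = c' ∨ b = v') → a < b → stt L n a < stt L n b := by
    intro a b ha hb
    refine stt_mono LP (by omega) ?_
    rintro ⟨h1, h2⟩
    have := hc1 a h1 ha
    omega
  have o2 : ∀ a b, (a = c ∨ a = v) → (b = c' ∨ b = v') → b < a → stt L n b < stt L n a := by
    intro a b ha hb
    refine stt_mono LP (by omega) ?_
    rintro ⟨h1, h2⟩
    have := hc2 b h1 hb
    omega
  have o : ∀ a b, (a = c ∨ a = v) → (b = c' ∨ b = v') →
      (a < b ∧ stt L n a < stt L n b) ∨ (a = b ∧ stt L n a = stt L n b) ∨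
      (b < a ∧ stt L n b < stt L n a) := by
    intro a b ha hb
    rcases lt_trichotomy a b with h1 | h1 | h1
    · exact Or.inl ⟨h1, o1 a b ha hb h1⟩
    · exact Or.inr (Or.inl ⟨h1, by rw [h1]⟩)
    · exact Or.inr (Or.inr ⟨h1, o2 a b ha hb h1⟩)
  have q1 := o c c' (by simp) (by simp)
  have q2 := o c v' (by simp) (by simp)
  have q3 := o v c' (by simp) (by simp)
  have q4 := o v v' (by simp) (by simp)
  have S := sums hh LP CX K T U
  have S' := sums hh LP CX K T' U'
  exact final_aux c v c' v' _ _ _ _ h n n1 n2 n3 n4 q1 q2 q3 q4 S.1 S.2.1 S.2.2.1 S.2.2.2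
    S'.1 S'.2.1 Z

end
end BPartition

namespace BPartition

open Classical in
/-- action on positions for i = 0 -/
noncomputable def st0 (h p : ℤ) : ℤ := if h ∣ p + 1 then p + 2 else p

theorem st0_cases (h p : ℤ) : (st0 h p = p + 2 ∧ h ∣ p + 1) ∨ (st0 h p = p ∧ ¬ h ∣ p + 1) := by
  unfold st0
  split_ifs with h1
  · exact Or.inl ⟨rfl, h1⟩
  · exact Or.inr ⟨rfl, h1⟩

section
variable {n h : ℕ} {X Y Y' : ℤ → Prop} {c v c' v' : ℤ}

theorem dvd_shift {h a b : ℤ} (k : ℤ) (ha : h ∣ a) (e : b = a + k * h) : h ∣ b := by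
  rw [e]; exact dvd_add ha (Dvd.intro_left k rfl)

theorem pos_one (T : Ty h n X Y c v) (U : ∀ z, 0 < z → (h : ℤ) ∣ z - 1 → ¬ Y z)
    (hn : 1 ≤ n) (hh : h = 2 * n + 1) :
    ¬ (h : ℤ) ∣ c - 1 ∧ ¬ (h : ℤ) ∣ v - 1 := by
  have nd : ∀ z : ℤ, (h : ℤ) ∣ z - 1 → ¬ (h : ℤ) ∣ z := by
    intro z h1 h2
    have := dvd_sub h2 h1
    exact not_dvd_small (h := h) (m := 1) (by omega) (by omega) (by simpa using this)
  obtain ⟨t1, t2, t3, t4, ⟨a1, a2, a3, a4⟩ | ⟨b1, b2⟩ | ⟨b1, b2⟩⟩ := T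
  · constructor
    · intro h1
      exact U c (by omega) h1 ((a4 _ (nd _ h1)).2 (by simp))
    · intro h1
      exact U v (by omega) h1 ((a4 _ (nd _ h1)).2 (by simp))
  · have : ¬ (h : ℤ) ∣ v - 1 := by
      intro h1
      exact U v (by omega) h1 ((b2 _ (nd _ h1)).2 (by right; left; exact b1))
    refine ⟨fun h1 => this (dvd_shift 1 h1 (by omega)), this⟩
  · have hc : ¬ (h : ℤ) ∣ c - 1 := by
      intro h1
      exact U c (by omega) h1 ((b2 _ (nd _ h1)).2 (by simp))
    refine ⟨hc, fun h1 => ?_⟩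
    rcases b1 with b1 | b1
    · exact hc (dvd_shift 1 h1 (by omega))
    · exact U v (by omega) h1 ((b2 _ (nd _ h1)).2 (by right; right; exact b1))

theorem pos_hm (T : Ty h n X Y c v) (U : ∀ z, 0 < z → (h : ℤ) ∣ z - 1 → ¬ Y z)
    (hn : 1 ≤ n) (hh : h = 2 * n + 1) : c ≠ h - 1 ∧ v ≠ h - 1 := by
  have P := pos_one T U hn hh
  have y1 : ¬ Y 1 := U 1 (by omega) (by simp)
  have n1 : ¬ (h : ℤ) ∣ 1 := not_dvd_small (by omega) (by omega)
  obtain ⟨t1, t2, t3, t4, ⟨a1, a2, a3, a4⟩ | ⟨b1, b2⟩ | ⟨b1, b2⟩⟩ := T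
  · constructor
    · intro h1
      exact y1 ((a4 _ n1).2 (by omega))
    · intro h1
      exact y1 ((a4 _ n1).2 (by omega))
  · refine ⟨fun h1 => y1 ((b2 _ n1).2 (by omega)), by omega⟩
  · constructor
    · intro h1
      exact P.2 (dvd_shift (a := 0) 1 (dvd_zero _) (by omega))
    · intro h1
      rcases b1 with b1 | b1
      · exact y1 ((b2 _ n1).2 (by omega))
      · exact P.1 (dvd_shift (a := 0) 1 (dvd_zero _) (by omega))

theorem pos_mul (CX : CoreX h X) (T : Ty h n X Y c v) :
    ((h : ℤ) ∣ c → c = h) ∧ ((h : ℤ) ∣ v → v = h ∨ (v = 2 * h ∧ c = h)) := by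
  have key : ∀ c : ℤ, n < c → X (c - h) → (h : ℤ) ∣ c → c = h := by
    intro c h0 h1 h2
    have := (CX.mul _ (dvd_sub h2 (dvd_refl _))).1 h1
    have := Int.le_of_dvd (by omega) h2
    omega
  obtain ⟨t1, t2, t3, t4, ⟨a1, a2, a3, a4⟩ | ⟨b1, b2⟩ | ⟨b1, b2⟩⟩ := T
  · exact ⟨key c t1 t3, fun h1 => Or.inl (key v t2 a2 h1)⟩
  · refine ⟨key c t1 t3, fun h1 => ?_⟩
    have := key c t1 t3 (dvd_shift (-1) h1 (by omega))
    omega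
  · refine ⟨key c t1 t3, fun h1 => ?_⟩
    rcases b1 with b1 | b1
    · have := key c t1 t3 (dvd_shift 1 h1 (by omega))
      omega
    · have := key c t1 t3 (dvd_shift (a := -v) 2 (by simpa using h1) (by omega))
      omega

theorem pos_neg (hn : 1 ≤ n) (hh : h = 2 * n + 1) {c : ℤ} (h1 : (n : ℤ) < c) (h2 : c ≠ h - 1)
    (h3 : (h : ℤ) ∣ c + 1) : 2 * (h : ℤ) - 1 ≤ c := by
  obtain ⟨k, hk⟩ := h3
  have : 1 < k := by
    by_contra h4
    rcases (show k ≤ 0 ∨ k = 1 by omega) with h5 | h5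
    · nlinarith
    · subst h5; omega
  nlinarith

theorem clash0 (hn : 1 ≤ n) (hh : h = 2 * n + 1) (CX : CoreX h X)
    (T : Ty h n X Y c v) (U : ∀ z, 0 < z → (h : ℤ) ∣ z - 1 → ¬ Y z)
    (T' : Ty h n X Y' c' v') (U' : ∀ z, 0 < z → (h : ℤ) ∣ z - 1 → ¬ Y' z)
    (B' : c' = h → v' = 2 * h → X (2 * h - 1)) {a b : ℤ}
    (ha : a = c ∨ a = v) (hb : b = c' ∨ b = v') (hab : a < b) (hs : st0 h b ≤ st0 h a) :
    c' = h ∧ v' = 2 * h ∧ v = 2 * h - 1 ∧ c = 3 * h - 1 := by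
  have P := pos_one T U hn hh
  have P' := pos_one T' U' hn hh
  have Q := pos_hm T U hn hh
  have Q' := pos_hm T' U' hn hh
  have R' := pos_mul CX T'
  have pa : ¬ (h : ℤ) ∣ a - 1 := by rcases ha with rfl | rfl; exacts [P.1, P.2]
  have pb : ¬ (h : ℤ) ∣ b - 1 := by rcases hb with rfl | rfl; exacts [P'.1, P'.2]
  rcases st0_cases h a with ⟨e1, f1⟩ | ⟨e1, f1⟩
  swap
  · rcases st0_cases h b with ⟨e2, f2⟩ | ⟨e2, f2⟩ <;> omega
  have hb2 : b = a + 1 := by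
    rcases st0_cases h b with ⟨e2, f2⟩ | ⟨e2, f2⟩
    · omega
    · have : b ≠ a + 2 := by
        rintro rfl
        exact pb (by rwa [show a + 2 - 1 = a + 1 by ring])
      omega
  have T1 := T.1
  have T2 := T.2.1
  have a1 := pos_neg hn hh (c := a) (by omega) (by omega) f1
  have hbd : (h : ℤ) ∣ b := by rwa [hb2]
  have e : c' = h ∧ v' = 2 * h := by
    rcases hb with rfl | rfl
    · have := R'.1 hbd; omega
    · have := R'.2 hbd; omega
  refine ⟨e.1, e.2, ?_⟩
  have hX := B' e.1 e.2
  have hae : a = 2 * h - 1 := by omega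
  rw [← hae] at hX
  obtain ⟨t1, t2, t3, t4, ⟨a1, a2, a3, a4⟩ | ⟨b1, b2⟩ | ⟨b1, b2⟩⟩ := T
  · rcases ha with rfl | rfl
    · exact absurd hX t4
    · exact absurd hX a3
  · rcases ha with rfl | rfl
    · exact absurd hX t4
    · omega
  · rcases ha with rfl | rfl
    · exact absurd hX t4
    · omega

theorem final_aux0 (c v c' v' a b a' b' h : ℤ)
    (q1 : (c < c' ∧ a < a') ∨ (c = c' ∧ a = a') ∨ (c' < c ∧ a' < a))
    (q2 : (c < v' ∧ a < b') ∨ (c = v' ∧ a = b') ∨ (v' < c ∧ b' < a))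
    (q3 : (v < c' ∧ b < a') ∨ (v = c' ∧ b = a') ∨ (c' < v ∧ a' < b))
    (q4 : (v < v' ∧ b < b') ∨ (v = v' ∧ b = b') ∨ (v' < v ∧ b' < b))
    (S1 : c + v ≤ 2 * h → a + b = c + v) (S2 : 2 * h < c + v → 2 * h < a + b)
    (S1' : c' + v' ≤ 2 * h → a' + b' = c' + v') (S2' : 2 * h < c' + v' → 2 * h < a' + b') :
    DomZ h c v c' v' ↔ DomZ h a b a' b' := by
  rw [DomZ_iff, DomZ_iff]
  rw [(tri q1).1, (tri q2).1, (tri q3).1, (tri q4).1]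
  rw [(tri q1).2.1, (tri q2).2.1, (tri q3).2.1, (tri q4).2.1]
  clear q1 q2 q3 q4
  have : (c + v ≤ 2 * h ∧ c + v ≤ c' + v') ↔ (a + b ≤ 2 * h ∧ a + b ≤ a' + b') := by omega
  rw [this]

theorem main_zero (hn : 1 ≤ n) (hh : h = 2 * n + 1) (CX : CoreX h X)
    (T : Ty h n X Y c v) (U : ∀ z, 0 < z → (h : ℤ) ∣ z - 1 → ¬ Y z)
    (B : c = h → v = 2 * h → X (2 * h - 1))
    (T' : Ty h n X Y' c' v') (U' : ∀ z, 0 < z → (h : ℤ) ∣ z - 1 → ¬ Y' z)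
    (B' : c' = h → v' = 2 * h → X (2 * h - 1)) :
    DomZ h c v c' v' ↔ DomZ h (st0 h c) (st0 h v) (st0 h c') (st0 h v') := by
  have e1 : st0 h h = h := by
    rcases st0_cases h h with ⟨e2, f2⟩ | ⟨e2, f2⟩
    · exact absurd (dvd_shift (b := 1) (-1) f2 (by ring)) (not_dvd_small (by omega) (by omega))
    · exact e2
  have e2 : st0 h (2 * h) = 2 * h := by
    rcases st0_cases h (2 * h) with ⟨e2, f2⟩ | ⟨e2, f2⟩
    · exact absurd (dvd_shift (b := 1) (-2) f2 (by ring)) (not_dvd_small (by omega) (by omega))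
    · exact e2
  have e3 : st0 h (2 * h - 1) = 2 * h + 1 := by
    unfold st0
    rw [if_pos (dvd_shift (a := 0) 2 (dvd_zero _) (by ring))]; ring
  have e4 : st0 h (3 * h - 1) = 3 * h + 1 := by
    unfold st0
    rw [if_pos (dvd_shift (a := 0) 3 (dvd_zero _) (by ring))]; ring
  by_cases hc1 : ∃ a b, (a = c ∨ a = v) ∧ (b = c' ∨ b = v') ∧ a < b ∧ st0 h b ≤ st0 h a
  · obtain ⟨a, b, ha, hb, hab, hs⟩ := hc1
    obtain ⟨rfl, rfl, rfl, rfl⟩ := clash0 hn hh CX T U T' U' B' ha hb hab hs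
    rw [e1, e2, e3, e4, DomZ_iff, DomZ_iff]
    omega
  by_cases hc2 : ∃ a b, (a = c' ∨ a = v') ∧ (b = c ∨ b = v) ∧ a < b ∧ st0 h b ≤ st0 h a
  · obtain ⟨a, b, ha, hb, hab, hs⟩ := hc2
    obtain ⟨rfl, rfl, rfl, rfl⟩ := clash0 hn hh CX T' U' T U B ha hb hab hs
    rw [e1, e2, e3, e4, DomZ_iff, DomZ_iff]
    omega
  push Not at hc1 hc2
  have o : ∀ a b, (a = c ∨ a = v) → (b = c' ∨ b = v') →
      (a < b ∧ st0 h a < st0 h b) ∨ (a = b ∧ st0 h a = st0 h b) ∨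
      (b < a ∧ st0 h b < st0 h a) := by
    intro a b ha hb
    rcases lt_trichotomy a b with h1 | h1 | h1
    · exact Or.inl ⟨h1, hc1 a b ha hb h1⟩
    · exact Or.inr (Or.inl ⟨h1, by rw [h1]⟩)
    · exact Or.inr (Or.inr ⟨h1, hc2 b a hb ha h1⟩)
  have sm : ∀ {Y : ℤ → Prop} {c v : ℤ}, Ty h n X Y c v →
      (∀ z, 0 < z → (h : ℤ) ∣ z - 1 → ¬ Y z) →
      (c + v ≤ 2 * h → st0 h c + st0 h v = c + v) ∧
      (2 * h < c + v → 2 * h < st0 h c + st0 h v) := by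
    intro Y c v T U
    have Q := pos_hm T U hn hh
    have p1 := pos_neg hn hh T.1 Q.1
    have p2 := pos_neg hn hh T.2.1 Q.2
    have t1 := T.1
    have t2 := T.2.1
    clear hc1 hc2 o
    rcases st0_cases h c with ⟨e2, f2⟩ | ⟨e2, f2⟩ <;>
    rcases st0_cases h v with ⟨e3, f3⟩ | ⟨e3, f3⟩
    · have := p1 f2; omega
    · have := p1 f2; omega
    · have := p2 f3; omega
    · omega
  exact final_aux0 c v c' v' _ _ _ _ h (o c c' (by simp) (by simp)) (o c v' (by simp) (by simp))
    (o v c' (by simp) (by simp)) (o v v' (by simp) (by simp)) (sm T U).1 (sm T U).2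
    (sm T' U').1 (sm T' U').2

end
end BPartition

namespace BPartition

theorem dom_DomZ {n h : ℕ} (hh : h = 2 * n + 1) {u v u' v' : ℕ} (hu : n < u) (hv : n < v)
    (hu' : n < u') (hv' : n < v') :
    (∀ x, gg h u x + gg h v x ≤ gg h u' x + gg h v' x) ↔ DomZ h u v u' v' := by
  rw [DomZ_iff]
  rcases le_total u v with h1 | h1 <;> rcases le_total u' v' with h2 | h2
  · rw [dom_char hh hu h1 hu' h2]; omega
  · simp only [add_comm (gg h u' _)]
    rw [dom_char hh hu h1 hv' h2]; omega
  · simp only [add_comm (gg h u _)]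
    rw [dom_char hh hv h1 hu' h2]; omega
  · simp only [add_comm (gg h u _), add_comm (gg h u' _)]
    rw [dom_char hh hv h1 hv' h2]; omega

theorem FF_g {n h : ℕ} (hh : h = 2 * n + 1) {lam nu : BPartition} {v : ℕ}
    (st : barStepRec h lam nu v) (φ : ℕ → ℕ) (hφ : φ 0 = 0) (g : ℕ)
    (g1 : h ≤ v → φ (v - h) + g = φ v) (g2 : v < h → g = φ v + φ (h - v)) :
    FF φ lam = FF φ nu + g := by
  obtain ⟨-, ⟨h1, h2⟩ | ⟨h1, h2⟩⟩ := step_FF hh st φ hφ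
  · have := g1 h1; omega
  · have := g2 h1; omega

theorem FF_id {n h : ℕ} (hh : h = 2 * n + 1) {lam nu : BPartition} {v : ℕ}
    (st : barStepRec h lam nu v) (x : ℕ) :
    FF (fun p => p - x) lam = FF (fun p => p - x) nu + gg h v x := by
  refine FF_g hh st _ (by simp) _ ?_ ?_ <;> intro h1 <;> unfold gg <;> split_ifs <;> omega

theorem FF_sw {n h : ℕ} (hh : h = 2 * n + 1) {L : ℤ → Prop} (LP : LProp h L)
    {lam nu : BPartition} {v : ℕ} (st : barStepRec h lam nu v) :
    ∃ w : ℕ, n < w ∧ (w : ℤ) = stt L n v ∧ ∀ x,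
      FF (fun p => sw L p - x) lam = FF (fun p => sw L p - x) nu + gg h w x := by
  have hnv : n < v := (step_FF hh st (fun _ => 0) rfl).1
  have s0 : sw L 0 = 0 := by
    unfold sw
    rw [if_neg, if_neg]
    · intro h1; exact LP.nd' _ h1 (by simp)
    · intro h1; exact LP.nd _ h1 (by simp)
  have vh : L ((v : ℤ) - 1) → v ≠ h := by
    rintro h1 rfl; exact LP.nd' _ h1 (by simp)
  have vh' : L v → v + 1 ≠ h := by
    rintro h1 h2
    exact LP.nd' _ h1 (by rw [← h2]; push_cast; exact dvd_refl _)
  have r1 : v < h → (L v ↔ L (((h - v : ℕ) : ℤ) - 1)) := by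
    intro h1
    constructor
    · intro h2
      have := LP.add _ (LP.mir _ h2)
      rwa [show -1 - (v : ℤ) + h = ((h - v : ℕ) : ℤ) - 1 by omega] at this
    · intro h2
      have := LP.add _ (LP.mir _ h2)
      rwa [show -1 - (((h - v : ℕ) : ℤ) - 1) + h = v by omega] at this
  have r2 : v < h → (L ((v : ℤ) - 1) ↔ L ((h - v : ℕ) : ℤ)) := by
    intro h1
    constructor
    · intro h2
      have := LP.add _ (LP.mir _ h2)
      rwa [show -1 - ((v : ℤ) - 1) + h = ((h - v : ℕ) : ℤ) by omega] at this
    · intro h2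
      have := LP.add _ (LP.mir _ h2)
      rwa [show -1 - ((h - v : ℕ) : ℤ) + h = (v : ℤ) - 1 by omega] at this
  have r3 : h ≤ v → (L v ↔ L ((v - h : ℕ) : ℤ)) := by
    intro h1
    constructor
    · intro h2
      have := LP.sub _ h2
      rwa [show (v : ℤ) - h = ((v - h : ℕ) : ℤ) by omega] at this
    · intro h2
      have := LP.add _ h2
      rwa [show ((v - h : ℕ) : ℤ) + h = v by omega] at this
  have r4 : h ≤ v → (L ((v : ℤ) - 1) ↔ L (((v - h : ℕ) : ℤ) - 1)) := by
    intro h1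
    constructor
    · intro h2
      have := LP.sub _ h2
      rwa [show (v : ℤ) - 1 - h = ((v - h : ℕ) : ℤ) - 1 by omega] at this
    · intro h2
      have := LP.add _ h2
      rwa [show ((v - h : ℕ) : ℤ) - 1 + h = v - 1 by omega] at this
  have r5 : L v → ¬ L ((v : ℤ) - 1) := fun h1 h2 => LP.succ _ h2 (by rwa [sub_add_cancel])
  rcases stt_cases L n v with ⟨e, f⟩ | ⟨e, f1, f2, f3⟩ | ⟨e, f1, f2⟩
  · have f' := r5 f
    have sv : sw L v = v + 1 := by unfold sw; rw [if_pos f]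
    refine ⟨v + 1, by omega, by omega, fun x => ?_⟩
    refine FF_g hh st _ (by rw [s0]; simp) _ ?_ ?_ <;> intro h1
    · have : sw L (v - h) = v - h + 1 := by unfold sw; rw [if_pos ((r3 h1).1 f)]
      rw [sv, this]; unfold gg; split_ifs <;> omega
    · have : sw L (h - v) = h - v - 1 := by
        unfold sw; rw [if_neg (mt (r2 h1).2 f'), if_pos ((r1 h1).1 f)]
      have := vh' f
      rw [sv, ‹sw L (h - v) = _›]; unfold gg; split_ifs <;> omega
  · have sv : sw L v = v - 1 := by unfold sw; rw [if_neg f3, if_pos f1]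
    have := vh f1
    refine ⟨v - 1, by omega, by omega, fun x => ?_⟩
    refine FF_g hh st _ (by rw [s0]; simp) _ ?_ ?_ <;> intro h1
    · have : sw L (v - h) = v - h - 1 := by
        unfold sw; rw [if_neg (mt (r3 h1).2 f3), if_pos ((r4 h1).1 f1)]
      rw [sv, this]; unfold gg; split_ifs <;> omega
    · have : sw L (h - v) = h - v + 1 := by
        unfold sw; rw [if_pos ((r2 h1).1 f1)]
      rw [sv, this]; unfold gg; split_ifs <;> omega
  · refine ⟨v, hnv, e.symm, fun x => ?_⟩
    by_cases f3 : L ((v : ℤ) - 1)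
    · have sv : sw L v = v - 1 := by unfold sw; rw [if_neg f1, if_pos f3]
      have := f2 f3
      refine FF_g hh st _ (by rw [s0]; simp) _ ?_ ?_ <;> intro h1
      · have := vh f3
        omega
      · have : sw L (h - v) = h - v + 1 := by
          unfold sw; rw [if_pos ((r2 h1).1 f3)]
        rw [sv, this]; unfold gg; split_ifs <;> omega
    · have sv : sw L v = v := by unfold sw; rw [if_neg f1, if_neg f3]
      refine FF_g hh st _ (by rw [s0]; simp) _ ?_ ?_ <;> intro h1
      · have : sw L (v - h) = v - h := by
          unfold sw; rw [if_neg (mt (r3 h1).2 f1), if_neg (mt (r4 h1).2 f3)]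
        rw [sv, this]; unfold gg; split_ifs <;> omega
      · have : sw L (h - v) = h - v := by
          unfold sw; rw [if_neg (mt (r2 h1).2 f3), if_neg (mt (r1 h1).2 f1)]
        rw [sv, this]; unfold gg; split_ifs <;> omega

theorem FF_sw0 {n h : ℕ} (hn : 1 ≤ n) (hh : h = 2 * n + 1)
    {lam nu : BPartition} {v : ℕ} (st : barStepRec h lam nu v) (hv : (v : ℤ) ≠ h - 1) :
    ∃ w : ℕ, n < w ∧ (w : ℤ) = st0 h v ∧ ∀ x,
      FF (fun p => sw0 h p - x) lam = FF (fun p => sw0 h p - x) nu + gg h w x := by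
  have hnv : n < v := (step_FF hh st (fun _ => 0) rfl).1
  have s0 : sw0 h 0 = 0 := by
    unfold sw0
    rw [if_neg]
    intro h1
    have := Nat.le_of_dvd (by omega) h1
    omega
  have hw : (sw0 h v : ℤ) = st0 h v := by
    unfold sw0 st0
    have : (h : ℤ) ∣ v + 1 ↔ h ∣ v + 1 := by norm_cast
    simp only [this]
    split_ifs <;> push_cast <;> rfl
  have hge : v ≤ sw0 h v := by unfold sw0; split_ifs <;> omega
  refine ⟨sw0 h v, by omega, hw, fun x => ?_⟩
  refine FF_g hh st _ (by rw [s0]; simp) _ ?_ ?_ <;> intro h1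
  · have : sw0 h (v - h) + h = sw0 h v := by
      unfold sw0
      have : h ∣ v + 1 ↔ h ∣ v - h + 1 := by
        rw [show v + 1 = v - h + 1 + h by omega]
        exact (Nat.dvd_add_iff_left (dvd_refl h)).symm
      simp only [this]
      split_ifs <;> omega
    unfold gg; split_ifs <;> omega
  · have s1 : sw0 h v = v := by
      unfold sw0; rw [if_neg]
      intro h2
      have := Nat.le_of_dvd (by omega) h2
      omega
    have s2 : sw0 h (h - v) = h - v := by
      unfold sw0; rw [if_neg]
      intro h2
      have := Nat.le_of_dvd (by omega) h2
      omega
    rw [s1, s2]; unfold gg; split_ifs <;> omega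

theorem U_of {n h i : ℕ} (hh : h = 2 * n + 1) (hi : i ≤ n) (hi1 : 1 ≤ i)
    {lam : BPartition} (hs : IsHStrict h lam) (hu : ∀ x, ¬ Removable h i lam x) :
    ∀ z, LL h i z → dbl lam (z + 1) → dbl lam z := by
  have LP := LProp_LL hh hi hi1
  have key : ∀ p : ℕ, 0 < p → LL h i (p : ℤ) → p + 1 ∈ partsM lam → p ∈ partsM lam := by
    intro p hp hL hm
    obtain ⟨-, r, hr⟩ := mem_partsM.1 hm
    have := next_of_right hh hi hi1 hs hu r (by rw [hr]; push_cast; simpa using hL)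
    exact mem_partsM.2 ⟨hp, r + 1, by omega⟩
  intro z hL hz
  have z0 : z ≠ 0 := fun h0 => LP.nd _ hL (by simp [h0])
  have z1 : z + 1 ≠ 0 := fun h0 => LP.nd' _ hL (by simp [h0])
  rcases lt_or_gt_of_ne z0 with h1 | h1
  · rw [dbl_neg' lam (x := z.natAbs) (by omega) (by omega)]
    rw [dbl_neg' lam (x := z.natAbs - 1) (by omega) (by omega)] at hz
    intro hm
    apply hz
    apply key _ (by omega)
    · have := LP.mir _ hL
      rwa [show -1 - z = ((z.natAbs - 1 : ℕ) : ℤ) by omega] at this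
    · rwa [Nat.sub_add_cancel (by omega)]
  · rw [dbl_pos' lam (x := z.natAbs) (by omega) (by omega)]
    rw [dbl_pos' lam (x := z.natAbs + 1) (by omega) (by omega)] at hz
    apply key _ (by omega) _ hz
    rwa [show ((z.natAbs : ℕ) : ℤ) = z by omega]

theorem K_of {n h i : ℕ} (hh : h = 2 * n + 1) (hi : i ≤ n) (hi1 : 1 ≤ i)
    {σ : BPartition} (hσ : IsBarCore h σ) {x : ℕ × ℕ} (ha : Addable h i σ x) :
    ∀ z, LL h i z → dbl σ (z + 1) → dbl σ (z + h) := by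
  have LP := LProp_LL hh hi hi1
  have CX := coreX hh hσ
  obtain ⟨-, hx, nu, hs, hsub, hxn, hres⟩ := ha
  have hle := diagram_sub_iff.1 hsub
  have hres' : ∀ r c, σ.parts r < c → c ≤ nu.parts r → colRes h c = i := by
    intro r c h1 h2
    refine hres (r, c) ⟨by simp only; omega, h2⟩ ?_
    rintro ⟨-, h3⟩
    simp only at h3
    omega
  have hne : nu.parts x.1 ≠ σ.parts x.1 := by
    intro h1
    apply hx
    exact ⟨hxn.1, h1 ▸ hxn.2⟩
  rcases row_ext hh hi hi1 hs hle hres' x.1 with h1 | ⟨-, h2, h3⟩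
  · exact absurd h1 hne
  set p := σ.parts x.1 with hp
  have p0 : p ≠ 0 := by
    intro h0
    exact LP.nd _ h2 (by simp [h0])
  have X1 : dbl σ p := (dbl_pos σ (by omega)).2 (mem_partsM.2 ⟨by omega, x.1, rfl⟩)
  have X2 : ¬ dbl σ (p + 1) := by
    rw [dbl_pos' σ (x := p + 1) (by omega) (by push_cast; rfl)]
    intro hm
    obtain ⟨-, r, hr⟩ := mem_partsM.1 hm
    exact h3 r hr
  have X3 : dbl σ (-1 - p) := by
    rw [show (-1 - (p : ℤ)) = -(p + 1) by ring]
    exact (CX.mir _ (by omega)).2 X2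
  have X4 : ¬ dbl σ (-p) := fun h1 => (CX.mir _ (by omega)).1 h1 X1
  have down : ∀ (k : ℕ) z, dbl σ z → dbl σ (z - h * k) := by
    intro k
    induction k with
    | zero => intro z hz; simpa using hz
    | succ k ih =>
      intro z hz
      have := CX.cl _ (ih z hz)
      rwa [show z - h * k - h = z - h * ((k + 1 : ℕ) : ℤ) by push_cast; ring] at this
  have key : ∀ q z : ℤ, dbl σ q → ¬ dbl σ (q + 1) → (h : ℤ) ∣ z - q → dbl σ (z + 1) →
      dbl σ (z + h) := by
    rintro q z hq1 hq2 ⟨m, hm⟩ hz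
    rcases lt_or_ge m 0 with h4 | h4
    · have := down (-m - 1).toNat q hq1
      rwa [Int.toNat_of_nonneg (by omega),
        show q - h * (-m - 1) = z + h by linear_combination -hm] at this
    · exfalso
      apply hq2
      have := down m.toNat (z + 1) hz
      rwa [Int.toNat_of_nonneg h4, show z + 1 - h * m = q + 1 by linear_combination hm] at this
  intro z hL hz
  have : (h : ℤ) ∣ z - p ∨ (h : ℤ) ∣ z - (-1 - p) := by
    rcases hL with h4 | h4 <;> rcases h2 with h5 | h5
    · left; exact dvd_eq' (dvd_sub h4 h5) (by ring)
    · right; exact dvd_eq' (dvd_add h4 h5) (by ring)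
    · right; exact dvd_eq' (dvd_add h4 h5) (by ring)
    · left; exact dvd_eq' (dvd_sub h4 h5) (by ring)
  rcases this with h4 | h4
  · exact key p z X1 X2 h4 hz
  · exact key _ z X3 (by rwa [show -1 - (p : ℤ) + 1 = -p by ring]) h4 hz

theorem U0_of {n h : ℕ} (hh : h = 2 * n + 1) (hn : 1 ≤ n) {lam : BPartition}
    (hs : IsHStrict h lam) (hu : ∀ x, ¬ Removable h 0 lam x) :
    ∀ z, 0 < z → (h : ℤ) ∣ z - 1 → ¬ dbl lam z := by
  intro z hz hd hY
  rw [dbl_pos' lam (x := z.toNat) (by omega) (by omega)] at hY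
  obtain ⟨-, r, hr⟩ := mem_partsM.1 hY
  refine no_one hh hn hs hu r (z.toNat - 1) (by omega) ?_
  have : ((z.toNat - 1 : ℕ) : ℤ) = z - 1 := by omega
  rw [← this] at hd
  exact_mod_cast hd

theorem B_of {n h : ℕ} (hh : h = 2 * n + 1) {lam nu σ : BPartition} {v c : ℕ}
    (hn : 1 ≤ n) (hσ : IsBarCore h σ) (hs : IsHStrict h lam) (hu : ∀ x, ¬ Removable h 0 lam x)
    (st1 : barStepRec h lam nu v) (st2 : barStepRec h nu σ c) :
    (c : ℤ) = h → (v : ℤ) = 2 * h → dbl σ (2 * h - 1) := by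
  intro e1 e2
  have T := Ty_of_steps hh hσ hs st1 st2
  have CX := coreX hh hσ
  have m := (step_mem hh hs st1).2.1 (by omega)
  obtain ⟨-, r, hr⟩ := mem_partsM.1 m
  have nx := next_zero hh hs hu
  have hm : 2 * h - 1 ∈ partsM lam := by
    by_contra hc
    have : ∀ k, lam.parts (r + k) = 2 * h := by
      intro k
      induction k with
      | zero => simp only [add_zero]; omega
      | succ k ih =>
        rcases nx (r + k) (by rw [ih]; exact Dvd.intro_left 2 rfl) with h1 | h1
        · rw [← ih, ← h1]; rfl
        · exfalso
          exact hc (mem_partsM.2 ⟨by omega, r + k + 1, by omega⟩)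
    obtain ⟨N, hN⟩ := exists_bound lam
    have h1 := this N
    have h2 := hN (r + N) (by omega)
    omega
  have hY : dbl lam (2 * h - 1) := (dbl_pos' lam (x := 2 * h - 1) (by omega) (by omega)).2 hm
  have nd : ¬ (h : ℤ) ∣ 2 * h - 1 := by
    intro h1
    exact not_dvd_small (h := (h : ℤ)) (m := (h : ℤ) - 1) (by omega) (by omega)
      (dvd_shift (-1) h1 (by ring))
  obtain ⟨t1, t2, t3, t4, ⟨a1, a2, a3, a4⟩ | ⟨b1, b2⟩ | ⟨b1, b2⟩⟩ := T
  · have := (CX.mul ((v : ℤ) - h) (dvd_shift (a := 0) 1 (dvd_zero _) (by omega))).1 a2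
    omega
  · rcases (b2 _ nd).1 hY with h1 | h1 | h1
    · exact h1.1
    · omega
    · omega
  · omega

end BPartition

namespace BPartition

open Classical in
/-- number of integers in `[a, b)` satisfying `X` -/
noncomputable def NN (X : ℤ → Prop) (a b : ℤ) : ℕ := ((Finset.Ico a b).filter X).card

theorem NN_add (X : ℤ → Prop) {a b c : ℤ} (h1 : a ≤ b) (h2 : b ≤ c) :
    NN X a c = NN X a b + NN X b c := by
  classical
  unfold NN
  rw [← Finset.Ico_union_Ico_eq_Ico h1 h2, Finset.filter_union, Finset.card_union_of_disjoint]
  exact Finset.disjoint_filter_filter (Finset.Ico_disjoint_Ico_consecutive a b c)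

theorem NN_one {X : ℤ → Prop} {a b : ℤ} (hb : b = a + 1) (h : X a) : NN X a b = 1 := by
  classical
  subst hb
  unfold NN
  rw [show Finset.Ico a (a + 1) = {a} by ext; simp; omega, Finset.filter_singleton, if_pos h]
  rfl

theorem NN_zero {X : ℤ → Prop} {a b : ℤ} (hb : b = a + 1) (h : ¬ X a) : NN X a b = 0 := by
  classical
  subst hb
  unfold NN
  rw [show Finset.Ico a (a + 1) = {a} by ext; simp; omega, Finset.filter_singleton, if_neg h]
  rfl

theorem NN_sym {X : ℤ → Prop} (h0 : X 0) (hm : ∀ z, z ≠ 0 → (X (-z) ↔ ¬ X z)) (m : ℕ) :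
    NN X (-m) (m + 1) = m + 1 := by
  induction m with
  | zero => exact NN_one (by simp) (by simpa using h0)
  | succ m ih =>
    push_cast
    rw [NN_add X (b := -(m : ℤ)) (by omega) (by omega),
      NN_add X (a := -(m : ℤ)) (b := (m : ℤ) + 1) (by omega) (by omega), ih]
    have := hm ((m : ℤ) + 1) (by omega)
    by_cases hx : X ((m : ℤ) + 1)
    · rw [NN_zero (by ring) (by tauto), NN_one (by ring) hx]; ring
    · rw [NN_one (by ring) (by tauto), NN_zero (by ring) hx]; ring

theorem NN_ncard (σ : BPartition) {p q : ℕ} (hp : 0 < p) :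
    NN (dbl σ) p q = Set.ncard {x : ℕ | p ≤ x ∧ x < q ∧ x ∈ partsM σ} := by
  classical
  unfold NN
  rw [← Set.ncard_coe_finset, ← Set.ncard_image_of_injective _ (Nat.cast_injective (R := ℤ))]
  congr 1
  ext z
  simp only [Finset.coe_filter, Finset.mem_Ico, Set.mem_ofPred_eq, Set.mem_image]
  constructor
  · rintro ⟨⟨h1, h2⟩, h3⟩
    rw [dbl_pos' σ (x := z.toNat) (by omega) (by omega)] at h3
    exact ⟨z.toNat, ⟨by omega, by omega, h3⟩, by omega⟩
  · rintro ⟨x, ⟨h1, h2, h3⟩, rfl⟩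
    exact ⟨by omega, (dbl_pos σ (by omega)).2 h3⟩

theorem leg_NN {n h : ℕ} (hh : h = 2 * n + 1) {lam nu σ : BPartition} (hσ : IsBarCore h σ)
    {c : ℕ} (hn : n < c) (hX : dbl σ ((c : ℤ) - h))
    (hsub : ∀ x : ℕ, x ∈ partsM σ → x < c → (c < h + x) → (h < c + x) → x ∈ partsM lam) :
    legLen h σ lam c + 1 = NN (dbl σ) ((c : ℤ) - h) c := by
  have CX := coreX hh hσ
  unfold legLen
  split_ifs with h1
  · rw [NN_add _ (b := (c : ℤ) - h + 1) (by omega) (by omega), NN_one rfl hX,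
      show (c : ℤ) - h + 1 = ((c - h + 1 : ℕ) : ℤ) by omega, NN_ncard σ (by omega), add_comm 1]
    congr 2
    ext x
    simp only [Set.mem_ofPred_eq]
    constructor
    · rintro ⟨a1, a2, a3, a4⟩
      exact ⟨by omega, a2, a4⟩
    · rintro ⟨a1, a2, a3⟩
      have := (mem_partsM.1 a3).1
      exact ⟨by omega, a2, hsub x a3 (by omega) (by omega) (by omega), a3⟩
  · have e := NN_sym ((CX.mul 0 (dvd_zero _)).2 le_rfl) CX.mir (h - c)
    rw [NN_add _ (b := ((h - c : ℕ) : ℤ) + 1) (by omega) (by omega),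
      show (c : ℤ) - h = -((h - c : ℕ) : ℤ) by omega, e,
      show ((h - c : ℕ) : ℤ) + 1 = ((h - c + 1 : ℕ) : ℤ) by omega, NN_ncard σ (by omega)]
    have : {x : ℕ | h - c < x ∧ x < c ∧ x ∈ partsM lam ∧ x ∈ partsM σ} =
        {x : ℕ | h - c + 1 ≤ x ∧ x < c ∧ x ∈ partsM σ} := by
      ext x
      simp only [Set.mem_ofPred_eq]
      constructor
      · rintro ⟨a1, a2, a3, a4⟩
        exact ⟨by omega, a2, a4⟩
      · rintro ⟨a1, a2, a3⟩
        exact ⟨by omega, a2, hsub x a3 (by omega) (by omega) (by omega), a3⟩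
    rw [this]
    omega

theorem NN_step {h : ℤ} (hh : 0 < h) {X : ℤ → Prop} (CX : CoreX h X) (c : ℤ) :
    NN X (c + 1 - h) (c + 1) ≤ NN X (c - h) c ∧
    (X (c - h) → ¬ X c → NN X (c + 1 - h) (c + 1) + 1 ≤ NN X (c - h) c) := by
  have e1 := NN_add X (a := c - h) (b := c) (c := c + 1) (by omega) (by omega)
  have e2 := NN_add X (a := c - h) (b := c + 1 - h) (c := c + 1) (by omega) (by omega)
  constructor
  · by_cases hx : X c
    · have := NN_one (X := X) (a := c) rfl hx
      have := NN_one (X := X) (a := c - h) (b := c + 1 - h) (by ring) (CX.cl _ hx)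
      omega
    · have := NN_zero (X := X) (a := c) rfl hx
      omega
  · intro h1 h2
    have := NN_zero (X := X) (a := c) rfl h2
    have := NN_one (X := X) (a := c - h) (b := c + 1 - h) (by ring) h1
    omega

theorem NN_mono {h : ℤ} (hh : 0 < h) {X : ℤ → Prop} (CX : CoreX h X) (c : ℤ) (k : ℕ) :
    NN X (c + k - h) (c + k) ≤ NN X (c - h) c := by
  induction k with
  | zero => simp
  | succ k ih =>
    have := (NN_step hh CX (c + k)).1
    push_cast
    rw [← add_assoc]
    omega

theorem NN_lt {h : ℤ} (hh : 0 < h) {X : ℤ → Prop} (CX : CoreX h X) {c d : ℤ} (hcd : c < d)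
    (h1 : X (c - h)) (h2 : ¬ X c) : NN X (d - h) d + 1 ≤ NN X (c - h) c := by
  have e1 := (NN_step hh CX c).2 h1 h2
  have e2 := NN_mono hh CX (c + 1) (d - c - 1).toNat
  rw [show c + 1 + ((d - c - 1).toNat : ℤ) = d by omega] at e2
  omega

/-- the legs of a partition with small bar positions -/
theorem legs {n h : ℕ} (hh : h = 2 * n + 1) {lam nu σ : BPartition} {v c : ℕ}
    (hσ : IsBarCore h σ) (hs : IsHStrict h lam)
    (st1 : barStepRec h lam nu v) (st2 : barStepRec h nu σ c) (hsum : c + v < 2 * h) :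
    dbl σ ((c : ℤ) - h) ∧ ¬ dbl σ c ∧ dbl σ ((v : ℤ) - h) ∧ ¬ dbl σ v ∧ c ≠ v ∧
    legLen h σ lam c + 1 = NN (dbl σ) ((c : ℤ) - h) c ∧
    legLen h σ lam v + 1 = NN (dbl σ) ((v : ℤ) - h) v := by
  have T := Ty_of_steps hh hσ hs st1 st2
  have cf := core_facts hh hσ
  obtain ⟨t1, t2, t3, t4, ⟨a1, a2, a3, a4⟩ | ⟨b1, b2⟩ | ⟨b1, b2⟩⟩ := T
  · have key : ∀ x : ℕ, x ∈ partsM σ → (x : ℤ) ≠ c - h → (x : ℤ) ≠ v - h → x ∈ partsM lam := by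
      intro x hx h1 h2
      have hx0 := (mem_partsM.1 hx).1
      rw [← dbl_pos lam hx0]
      refine (a4 _ ?_).2 (Or.inl ⟨(dbl_pos σ hx0).2 hx, h1, by omega, h2, by omega⟩)
      intro h3
      exact cf.1 x hx (by exact_mod_cast h3)
    refine ⟨t3, t4, a2, a3, by omega, ?_, ?_⟩
    · refine leg_NN (nu := nu) hh hσ (by omega) t3 fun x hx h1 h2 h3 => ?_
      have hx0 := (mem_partsM.1 hx).1
      exact key x hx (by omega) (by omega)
    · refine leg_NN (nu := nu) hh hσ (by omega) a2 fun x hx h1 h2 h3 => ?_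
      have hx0 := (mem_partsM.1 hx).1
      exact key x hx (by omega) (by omega)
  · omega
  · omega

theorem barpos {h : ℕ} {lam nu σ : BPartition} {v c : ℕ}
    (st1 : barStepRec h lam nu v) (st2 : barStepRec h nu σ c) :
    BarPositions h σ lam (min c v) (max c v) := by
  refine ⟨min_le_max, nu, v, c, st1, st2, ?_⟩
  rcases le_total c v with h1 | h1
  · rw [min_eq_left h1, max_eq_right h1]; exact Multiset.pair_comm _ _
  · rw [min_eq_right h1, max_eq_left h1]

theorem ddd_val {n h : ℕ} (hh : h = 2 * n + 1) {lam nu σ : BPartition} {v c : ℕ}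
    (hσ : IsBarCore h σ) (hs : IsHStrict h lam)
    (st1 : barStepRec h lam nu v) (st2 : barStepRec h nu σ c) (hsum : c + v < 2 * h) :
    ∃ a b : ℕ, a = min c v ∧ b = max c v ∧ a < b ∧
    dbl σ ((a : ℤ) - h) ∧ ¬ dbl σ a ∧ dbl σ ((b : ℤ) - h) ∧ ¬ dbl σ b ∧
    NN (dbl σ) ((b : ℤ) - h) b + ddd h σ lam (min c v) (max c v) = NN (dbl σ) ((a : ℤ) - h) a := by
  have CX := coreX hh hσ
  obtain ⟨l1, l2, l3, l4, l5, l6, l7⟩ := legs hh hσ hs st1 st2 hsum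
  rcases lt_or_gt_of_ne l5 with h1 | h1
  · refine ⟨c, v, (min_eq_left h1.le).symm, (max_eq_right h1.le).symm, h1, l1, l2, l3, l4, ?_⟩
    have := NN_lt (by omega) CX (show (c : ℤ) < v by omega) l1 l2
    rw [min_eq_left h1.le, max_eq_right h1.le, ddd, max_eq_left (by omega), min_eq_right (by omega)]
    omega
  · refine ⟨v, c, (min_eq_right h1.le).symm, (max_eq_left h1.le).symm, h1, l3, l4, l1, l2, ?_⟩
    have := NN_lt (by omega) CX (show (v : ℤ) < c by omega) l3 l4
    rw [min_eq_right h1.le, max_eq_left h1.le, ddd, max_eq_left (by omega), min_eq_right (by omega)]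
    omega

theorem Z_of {n h : ℕ} (hh : h = 2 * n + 1) {lam nu mu nu' σ : BPartition} {v c v' c' : ℕ}
    (hσ : IsBarCore h σ) (hs : IsHStrict h lam) (hs' : IsHStrict h mu)
    (st1 : barStepRec h lam nu v) (st2 : barStepRec h nu σ c)
    (st1' : barStepRec h mu nu' v') (st2' : barStepRec h nu' σ c')
    (hd : ∀ a b a' b', BarPositions h σ lam a b → BarPositions h σ mu a' b' →
      ((ddd h σ lam a b : ℤ) - (ddd h σ mu a' b' : ℤ)).natAbs ≤ 1) :
    min (c' : ℤ) v' < min (c : ℤ) v → max (c : ℤ) v < max (c' : ℤ) v' →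
    (c : ℤ) + v < 2 * h → (c' : ℤ) + v' < 2 * h → False := by
  intro z1 z2 z3 z4
  have CX := coreX hh hσ
  have D := hd _ _ _ _ (barpos st1 st2) (barpos st1' st2')
  obtain ⟨a, b, e1, e2, e3, l1, l2, l3, l4, l5⟩ := ddd_val hh hσ hs st1 st2 (by omega)
  obtain ⟨a', b', e1', e2', e3', l1', l2', l3', l4', l5'⟩ := ddd_val hh hσ hs' st1' st2' (by omega)
  have m1 : (a' : ℤ) < a := by rw [e1, e1']; push_cast; exact z1
  have m2 : (b : ℤ) < b' := by rw [e2, e2']; push_cast; exact z2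
  have k1 := NN_lt (by omega) CX m1 l1' l2'
  have k2 := NN_lt (by omega) CX m2 l3 l4
  clear z1 z2 e1 e2 e1' e2' hd
  omega

end BPartition

open BPartition in
/-- In a [2:k]-pair (P_{σ,2}, P_{τ,2}) of residue i with i ≥ 1 or k ≥ 3, if
λ, μ ∈ P_{σ,2} are unexceptional with |∂λ − ∂μ| ≤ 1, then λ ⊴ μ iff
ψ_i(λ) ⊴ ψ_i(μ). -/
theorem stmt15 (n h : ℕ) (hn : 1 ≤ n) (hh : h = 2 * n + 1) (i k : ℕ) (hi : i ≤ n)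
    (hk : 1 ≤ k) (σ : BPartition) (hσ : IsBarCore h σ)
    (hcnt : Set.ncard {x : ℕ × ℕ | Addable h i σ x} = k)
    (τ : BPartition) (hτ : τ = psi h i σ) (hik : 1 ≤ i ∨ 3 ≤ k)
    (lam mu : BPartition) (h1 : InBlock h σ 2 lam) (h2 : InBlock h σ 2 mu)
    (hu1 : ∀ x, ¬ Removable h i lam x) (hu2 : ∀ x, ¬ Removable h i mu x)
    (hd : ∀ a b a' b', BarPositions h σ lam a b → BarPositions h σ mu a' b' →
      ((ddd h σ lam a b : ℤ) - (ddd h σ mu a' b' : ℤ)).natAbs ≤ 1) :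
    domLE lam mu ↔ domLE (psi h i lam) (psi h i mu) := by
  obtain ⟨hs1, -, nu, ⟨v, st1⟩, x1, ⟨c, st2⟩, ex1⟩ := h1
  obtain ⟨hs2, -, nu', ⟨v', st1'⟩, x2, ⟨c', st2'⟩, ex2⟩ := h2
  have ex1' : x1 = σ := ex1
  have ex2' : x2 = σ := ex2
  rw [ex1'] at st2
  rw [ex2'] at st2'
  have CX := coreX hh hσ
  have T := Ty_of_steps hh hσ hs1 st1 st2
  have T' := Ty_of_steps hh hσ hs2 st1' st2'
  have t1 : n < c := by have := T.1; omega
  have t2 : n < v := by have := T.2.1; omega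
  have t1' : n < c' := by have := T'.1; omega
  have t2' : n < v' := by have := T'.2.1; omega
  have A : domLE lam mu ↔ DomZ h c v c' v' := by
    rw [domLE_iff, ← dom_DomZ hh t1 t2 t1' t2']
    refine forall_congr' fun x => ?_
    rw [FF_id hh st1 x, FF_id hh st2 x, FF_id hh st1' x, FF_id hh st2' x]
    omega
  rw [A]
  rcases Nat.eq_zero_or_pos i with h0 | hi1
  · subst h0
    have U := U0_of hh hn hs1 hu1
    have U' := U0_of hh hn hs2 hu2
    have P := pos_hm T U hn hh
    have P' := pos_hm T' U' hn hh
    rw [main_zero hn hh CX T U (B_of hh hn hσ hs1 hu1 st1 st2) T' U'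
      (B_of hh hn hσ hs2 hu2 st1' st2')]
    obtain ⟨w1, n1, e1, f1⟩ := FF_sw0 hn hh st1 P.2
    obtain ⟨w2, n2, e2, f2⟩ := FF_sw0 hn hh st2 P.1
    obtain ⟨w1', n1', e1', f1'⟩ := FF_sw0 hn hh st1' P'.2
    obtain ⟨w2', n2', e2', f2'⟩ := FF_sw0 hn hh st2' P'.1
    rw [domLE_iff, ← e1, ← e2, ← e1', ← e2', ← dom_DomZ hh n2 n1 n2' n1']
    refine forall_congr' fun x => ?_
    rw [FF_psi0 hh hn hs1 hu1, FF_psi0 hh hn hs2 hu2, f1, f2, f1', f2']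
    omega
  · have LP := LProp_LL hh hi hi1
    obtain ⟨x, hx⟩ : {x : ℕ × ℕ | Addable h i σ x}.Nonempty := by
      apply Set.nonempty_of_ncard_ne_zero
      omega
    rw [main_pos hh LP CX (K_of hh hi hi1 hσ hx) T (U_of hh hi hi1 hs1 hu1) T'
      (U_of hh hi hi1 hs2 hu2) (Z_of hh hσ hs1 hs2 st1 st2 st1' st2' hd)]
    obtain ⟨w1, n1, e1, f1⟩ := FF_sw hh LP st1
    obtain ⟨w2, n2, e2, f2⟩ := FF_sw hh LP st2
    obtain ⟨w1', n1', e1', f1'⟩ := FF_sw hh LP st1'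
    obtain ⟨w2', n2', e2', f2'⟩ := FF_sw hh LP st2'
    rw [domLE_iff, ← e1, ← e2, ← e1', ← e2', ← dom_DomZ hh n2 n1 n2' n1']
    refine forall_congr' fun x => ?_
    rw [FF_psi hh hi hi1 hs1 hu1, FF_psi hh hi hi1 hs2 hu2, f1, f2, f1', f2']
    omega
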